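/- arXiv:1307.2183 — 2 statements merged into one kernel-verified Lean document; each statement's English description precedes it below -/
import Mathlib

section
/- (Oh–Witte-Morris) Let 𝕂 be ℝ or ℂ and let H be a closed connected subgroup of SL(3,𝕂). If there exists a discrete subgroup Γ of SL(3,𝕂) whose action by left multiplication on the coset space SL(3,𝕂)/H is free, properly discontinuous and cocompact, then either H is compact or the coset space SL(3,𝕂)/H is compact. -/
open Matrix

/-- The matrix topology on `SL(3, 𝕂)`, induced from the space of matrices. -/
noncomputable instance (𝕂 : Type) [RCLike 𝕂] :
    TopologicalSpace (Matrix.SpecialLinearGroup (Fin 3) 𝕂) :=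
  TopologicalSpace.induced (fun g => (g : Matrix (Fin 3) (Fin 3) 𝕂)) inferInstance


namespace OWM

open Relation

/-- A coarse length function on a group, with chain-generation at scale `r` and finite nets at
scale `r`. -/
structure Coarse (A : Type*) [Group A] (len : A → ℝ) (r : ℝ) : Prop where
  mul : ∀ a b, len (a * b) ≤ len a + len b
  inv : ∀ a, len a⁻¹ = len a
  gen : ∀ a, ReflTransGen (fun x y => len (x⁻¹ * y) ≤ r) 1 a
  net : ∀ R : ℝ, ∃ F : Set A, F.Finite ∧ ∀ a, len a ≤ R → ∃ f ∈ F, len (f⁻¹ * a) ≤ r / 2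

/-- One step of a chain outside the ball of radius `R`. -/
def FarStep {A : Type*} [Group A] (len : A → ℝ) (r R : ℝ) (x y : A) : Prop :=
  R < len x ∧ R < len y ∧ len (x⁻¹ * y) ≤ r

/-- Chain-connectedness outside the ball of radius `R`. -/
def Far {A : Type*} [Group A] (len : A → ℝ) (r R : ℝ) : A → A → Prop :=
  ReflTransGen (FarStep len r R)

section ends
variable {A : Type*} [Group A] {len : A → ℝ} {r : ℝ}

lemma Coarse.nonneg (h : Coarse A len r) (a : A) : 0 ≤ len a := by
  have h1 := h.mul a a⁻¹
  have h2 := h.mul 1 1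
  have h3 := h.inv a
  rw [mul_inv_cancel] at h1
  rw [mul_one] at h2
  linarith

lemma Coarse.mul_ge (h : Coarse A len r) (a b : A) : len a - len b ≤ len (a * b) := by
  have h1 := h.mul (a * b) b⁻¹
  rw [mul_inv_cancel_right, h.inv] at h1
  linarith

lemma Coarse.mul_ge' (h : Coarse A len r) (a b : A) : len b - len a ≤ len (a * b) := by
  have h1 := h.mul a⁻¹ (a * b)
  rw [inv_mul_cancel_left, h.inv] at h1
  linarith

lemma Coarse.far_symm (h : Coarse A len r) {R : ℝ} {a b : A} (hab : Far len r R a b) :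
    Far len r R b a := by
  induction hab with
  | refl => exact ReflTransGen.refl
  | @tail x y _ hxy ih =>
    obtain ⟨h1, h2, h3⟩ := hxy
    refine ReflTransGen.head ⟨h2, h1, ?_⟩ ih
    rw [← h.inv]
    simpa using h3

lemma far_mono {R R' : ℝ} (hR : R ≤ R') {a b : A} (hab : Far len r R' a b) :
    Far len r R a b := by
  refine ReflTransGen.mono ?_ _ _ hab
  rintro x y ⟨h1, h2, h3⟩
  exact ⟨by linarith, by linarith, h3⟩

lemma far_trans {R : ℝ} {a b c : A} (hab : Far len r R a b) (hbc : Far len r R b c) :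
    Far len r R a c := ReflTransGen.trans hab hbc

/-- bounded elements are reached by bounded chains -/
lemma Coarse.bdd_chain (h : Coarse A len r) (R : ℝ) : ∃ M : ℝ, ∀ s, len s ≤ R →
    ReflTransGen (fun x y => len x ≤ M ∧ len y ≤ M ∧ len (x⁻¹ * y) ≤ r) 1 s := by
  have key : ∀ a : A, ∃ M : ℝ, R ≤ M ∧ len a ≤ M ∧
      ReflTransGen (fun x y => len x ≤ M ∧ len y ≤ M ∧ len (x⁻¹ * y) ≤ r) 1 a := by
    intro a
    induction h.gen a with
    | refl => exact ⟨max R (len 1), le_max_left _ _, le_max_right _ _, ReflTransGen.refl⟩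
    | @tail b c _ hbc ih =>
      obtain ⟨M, h1, h2, h3⟩ := ih
      refine ⟨max M (len c), h1.trans (le_max_left _ _), le_max_right _ _, ?_⟩
      refine ReflTransGen.tail (ReflTransGen.mono ?_ _ _ h3) ⟨h2.trans (le_max_left _ _),
        le_max_right _ _, hbc⟩
      rintro x y ⟨h4, h5, h6⟩
      exact ⟨h4.trans (le_max_left _ _), h5.trans (le_max_left _ _), h6⟩
  choose M hM using key
  obtain ⟨F, hF, hF'⟩ := h.net R
  obtain ⟨B, hB⟩ := (hF.image M).bddAbove
  refine ⟨B, fun s hs => ?_⟩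
  obtain ⟨f, hf, hfs⟩ := hF' s hs
  have hMB : M f ≤ B := hB ⟨f, hf, rfl⟩
  obtain ⟨h1, h2, h3⟩ := hM f
  refine ReflTransGen.tail (ReflTransGen.mono ?_ _ _ h3) ⟨h2.trans hMB, hs.trans (h1.trans hMB),
    by linarith [h.nonneg (f⁻¹ * s)]⟩
  rintro x y ⟨h4, h5, h6⟩
  exact ⟨h4.trans hMB, h5.trans hMB, h6⟩

/-- right multiplication by bounded elements preserves far components -/
lemma Coarse.far_mul (h : Coarse A len r) (R ρ : ℝ) : ∃ T : ℝ, R ≤ T ∧ ∀ a s, T < len a →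
    len s ≤ ρ → Far len r R a (a * s) := by
  obtain ⟨M, hM⟩ := h.bdd_chain ρ
  refine ⟨R + max M 0, by have := le_max_right M 0; linarith, fun a s ha hs => ?_⟩
  have := hM s hs
  have h2 : Far len r R (a * 1) (a * s) := by
    refine ReflTransGen.lift (fun x => a * x) ?_ _ _ this
    rintro x y ⟨h1, h2, h3⟩
    have hx := h.mul_ge a x
    have hy := h.mul_ge a y
    have := le_max_left M 0
    refine ⟨by linarith, by linarith, ?_⟩
    simpa [mul_assoc] using h3
  simpa using h2

/-- last exit from a ball -/
lemma Coarse.exit (h : Coarse A len r) (R : ℝ) (a : A) (ha : R < len a) :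
    ∃ b, len b ≤ max (R + r) (len 1) ∧ R < len b ∧ Far len r R b a := by
  revert ha
  induction h.gen a with
  | refl => exact fun ha => ⟨1, le_max_right _ _, ha, ReflTransGen.refl⟩
  | @tail b c _ hbc ih =>
    intro hc
    by_cases hb : R < len b
    · obtain ⟨d, h1, h2, h3⟩ := ih hb
      exact ⟨d, h1, h2, h3.tail ⟨hb, hc, hbc⟩⟩
    · refine ⟨c, ?_, hc, ReflTransGen.refl⟩
      have := h.mul b (b⁻¹ * c)
      rw [mul_inv_cancel_left] at this
      exact le_max_of_le_left (by linarith [not_lt.1 hb])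

/-- finitely many far components -/
lemma Coarse.finite_far (h : Coarse A len r) (R : ℝ) :
    ∃ F : Set A, F.Finite ∧ ∀ a, R < len a → ∃ f ∈ F, Far len r R f a := by
  obtain ⟨F, hF, hF'⟩ := h.net (max (R + r) (len 1))
  classical
  let φ : A → A := fun f =>
    if hf : ∃ b, R < len b ∧ len (f⁻¹ * b) ≤ r / 2 then hf.choose else 1
  refine ⟨φ '' F, hF.image _, fun a ha => ?_⟩
  obtain ⟨b, h1, h2, h3⟩ := h.exit R a ha
  obtain ⟨f, hf, hfb⟩ := hF' b h1
  refine ⟨φ f, ⟨f, hf, rfl⟩, ?_⟩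
  have hex : ∃ b, R < len b ∧ len (f⁻¹ * b) ≤ r / 2 := ⟨b, h2, hfb⟩
  have hφ : φ f = hex.choose := dif_pos hex
  have hc := hex.choose_spec
  rw [← hφ] at hc
  refine ReflTransGen.head ⟨hc.1, h2, ?_⟩ h3
  have h4 := h.mul (f⁻¹ * φ f)⁻¹ (f⁻¹ * b)
  rw [h.inv] at h4
  have h5 : (f⁻¹ * φ f)⁻¹ * (f⁻¹ * b) = (φ f)⁻¹ * b := by group
  rw [h5] at h4
  linarith [hc.2]

/-- products of far elements in general position -/
lemma Coarse.far_prod (h : Coarse A len r) (R : ℝ) : ∃ T : ℝ, R ≤ T ∧ ∀ a b, T < len a →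
    T < len b → ¬ Far len r R a⁻¹ b → Far len r R a (a * b) ∧ R < len (a * b) := by
  obtain ⟨T1, hT1, hT1'⟩ := h.far_mul R (max (R + r) (len 1))
  obtain ⟨T2, hT2, hT2'⟩ := h.far_mul R R
  refine ⟨max T1 T2, hT1.trans (le_max_left _ _), fun a b ha hb hab => ?_⟩
  have ha1 := lt_of_le_of_lt (le_max_left _ _) ha
  have ha2 := lt_of_le_of_lt (le_max_right _ _) ha
  have hb1 := lt_of_le_of_lt (le_max_left _ _) hb
  have claim : ∀ c, Far len r R c b → R < len (a * c) := by
    intro c hc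
    by_contra hcon
    have := hT2' a⁻¹ (a * c) (by rwa [h.inv]) (not_lt.1 hcon)
    rw [inv_mul_cancel_left] at this
    exact hab (far_trans this hc)
  obtain ⟨d, h1, h2, h3⟩ := h.exit R b (by linarith)
  refine ⟨far_trans (hT1' a d ha1 h1) ?_, claim b ReflTransGen.refl⟩
  clear h1 h2
  induction h3 using ReflTransGen.head_induction_on with
  | refl => exact ReflTransGen.refl
  | @head c e hce heb ih =>
    refine ReflTransGen.head ⟨claim c (ReflTransGen.head hce heb), claim e heb, ?_⟩ ih
    have := hce.2.2
    simpa [mul_assoc] using this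

/-- If no far element is chain-connected to its inverse, then the group is two-ended. -/
lemma Coarse.two_ended (h : Coarse A len r) (R : ℝ)
    (h2 : ∀ a, R < len a → ¬ Far len r R a a⁻¹) (unb : ∀ T : ℝ, ∃ a, T < len a) :
    ∃ S : Set A, (∃ T : ℝ, ∀ a, T < len a → (a⁻¹ ∈ S ↔ a ∉ S)) ∧
      (∀ ρ : ℝ, ∃ T : ℝ, ∀ a s, T < len a → len s ≤ ρ → (a * s ∈ S ↔ a ∈ S)) ∧
      (∀ Q : ℝ, ∃ T : ℝ, ∀ a ∈ S, ∀ b ∈ S, T < len a → T < len b →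
        a * b ∈ S ∧ Q < len (a * b)) := by
  obtain ⟨T0, hT0, prod⟩ := h.far_prod R
  obtain ⟨h0, hh0⟩ := unb T0
  have hh0' : T0 < len h0⁻¹ := by rwa [h.inv]
  have tri : ∀ g, T0 + 2 * len h0 < len g → Far len r R h0 g ∨ Far len r R h0⁻¹ g := by
    intro g hg
    by_contra hcon
    push Not at hcon
    obtain ⟨n1, n2⟩ := hcon
    have p0 := h.nonneg h0
    have hg' : T0 < len g := by linarith
    have hgi : T0 < len g⁻¹ := by rwa [h.inv]
    have hlg : T0 < len (h0 * g) := by have := h.mul_ge' h0 g; linarith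
    have hlg' : T0 < len (h0 * g)⁻¹ := by rwa [h.inv]
    have hlh : T0 < len (h0⁻¹ * g) := by
      have := h.mul_ge' h0⁻¹ g
      rw [h.inv] at this
      linarith
    have a1 := (prod h0 g hh0 hg' n2).1
    have a2 := (prod h0⁻¹ g hh0' hg' (by rwa [inv_inv])).1
    have a3 := (prod g⁻¹ h0⁻¹ hgi hh0' (by
      rw [inv_inv]; exact fun hc => n2 (h.far_symm hc))).1
    have a4 := (prod g⁻¹ h0 hgi hh0 (by
      rw [inv_inv]; exact fun hc => n1 (h.far_symm hc))).1
    have l1 : ¬ Far len r R g⁻¹ h0 := by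
      intro hc
      apply h2 (h0 * g) (by linarith)
      rw [_root_.mul_inv_rev]
      exact far_trans (h.far_symm a1) (far_trans (h.far_symm hc) a3)
    have l2 : ¬ Far len r R g⁻¹ h0⁻¹ := by
      intro hc
      apply h2 (h0⁻¹ * g) (by linarith)
      rw [_root_.mul_inv_rev, inv_inv]
      exact far_trans (h.far_symm a2) (far_trans (h.far_symm hc) a4)
    have l3 : ¬ Far len r R h0⁻¹ (h0 * g)⁻¹ := by
      intro hc
      rw [_root_.mul_inv_rev] at hc
      exact l2 (far_trans a3 (h.far_symm hc))
    have a5 := prod h0 (h0 * g)⁻¹ hh0 hlg' l3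
    have a6 := (prod (h0 * g) h0⁻¹ hlg hh0' (fun hc => l3 (h.far_symm hc))).1
    apply h2 _ a5.2
    have e : (h0 * (h0 * g)⁻¹)⁻¹ = h0 * g * h0⁻¹ := by group
    rw [e]
    exact far_trans (h.far_symm a5.1) (far_trans a1 a6)
  have inv_iff : ∀ a, T0 + 2 * len h0 < len a → (Far len r R h0 a⁻¹ ↔ ¬ Far len r R h0 a) := by
    intro a ha
    have p0 := h.nonneg h0
    constructor
    · intro h3 h4
      exact h2 a (by linarith) (far_trans (h.far_symm h4) h3)
    · intro h3
      rcases tri a ha with h4 | h4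
      · exact absurd h4 h3
      · rcases tri a⁻¹ (by rwa [h.inv]) with h5 | h5
        · exact h5
        · exact absurd (far_trans (h.far_symm h4) h5) (h2 a (by linarith))
  refine ⟨{a | Far len r R h0 a}, ⟨T0 + 2 * len h0, inv_iff⟩, ?_, ?_⟩
  · intro ρ
    obtain ⟨T, -, hT⟩ := h.far_mul R ρ
    refine ⟨T, fun a s ha hs => ?_⟩
    have := hT a s ha hs
    exact ⟨fun hc => far_trans hc (h.far_symm this), fun hc => far_trans hc this⟩
  · intro Q
    obtain ⟨T, hT, hT'⟩ := h.far_prod (max Q R)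
    refine ⟨max T (T0 + 2 * len h0), fun a ha b hb hla hlb => ?_⟩
    have k1 := lt_of_le_of_lt (le_max_left _ _) hla
    have k2 := lt_of_le_of_lt (le_max_right _ _) hla
    have k3 := lt_of_le_of_lt (le_max_left _ _) hlb
    have := hT' a b k1 k3 (by
      intro hc
      have hc' := far_mono (le_max_right Q R) hc
      exact (inv_iff a k2).1 (far_trans hb (h.far_symm hc')) ha)
    exact ⟨far_trans ha (far_mono (le_max_right Q R) this.1),
      lt_of_le_of_lt (le_max_left _ _) this.2⟩

end ends
end OWM

namespace OWM

section planar

lemma re_div_pos {z w : ℂ} {D : ℝ} (h1 : ‖w - z‖ ≤ D) (h2 : D < ‖z‖) : 0 < (w / z).re := by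
  have hz : z ≠ 0 := by
    rintro rfl
    have := norm_nonneg (w - 0)
    simp only [norm_zero] at h2
    linarith
  have e : w / z = 1 + (w - z) / z := by field_simp; ring
  have h3 : ‖(w - z) / z‖ < 1 := by
    rw [norm_div, div_lt_one (norm_pos_iff.2 hz)]
    linarith
  have h4 := (abs_le.1 (Complex.abs_re_le_norm ((w - z) / z))).1
  rw [e, Complex.add_re, Complex.one_re]
  linarith

lemma arg_cocycle {z1 z2 z3 : ℂ} (h12 : 0 < (z2 / z1).re) (h23 : 0 < (z3 / z2).re) :
    (z3 / z1).arg = (z2 / z1).arg + (z3 / z2).arg := by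
  have hz2 : z2 ≠ 0 := by
    rintro rfl
    simp at h12
  have e : z3 / z1 = (z2 / z1) * (z3 / z2) := by
    by_cases h : z1 = 0
    · simp [h]
    · field_simp
  have n1 : z2 / z1 ≠ 0 := by
    intro h; rw [h] at h12; simp at h12
  have n2 : z3 / z2 ≠ 0 := by
    intro h; rw [h] at h23; simp at h23
  have a1 := abs_lt.1 (Complex.abs_arg_lt_pi_div_two_iff.2 (Or.inl h12))
  have a2 := abs_lt.1 (Complex.abs_arg_lt_pi_div_two_iff.2 (Or.inl h23))
  rw [e, Complex.arg_mul n1 n2]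
  constructor <;> linarith [a1.1, a1.2, a2.1, a2.2]

lemma arg_div_upper {z w : ℂ} (hz : 0 ≤ z.im) (hw : 0 ≤ w.im) (h : 0 < (w / z).re) :
    (w / z).arg = w.arg - z.arg := by
  have n1 : w / z ≠ 0 := by
    intro h'; rw [h'] at h; simp at h
  have nz : z ≠ 0 := by
    rintro rfl; simp at n1
  have nw : w ≠ 0 := by
    rintro rfl; simp at n1
  have a1 := abs_lt.1 (Complex.abs_arg_lt_pi_div_two_iff.2 (Or.inl h))
  have b1 := Complex.arg_nonneg_iff.2 hz
  have b2 := Complex.arg_nonneg_iff.2 hw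
  have b3 := Complex.arg_le_pi z
  have b4 := Complex.arg_le_pi w
  have c : ((w / z).arg : Real.Angle) = ((w.arg - z.arg : ℝ) : Real.Angle) := by
    rw [Complex.arg_div_coe_angle nw nz, Real.Angle.coe_sub]
  obtain ⟨k, hk⟩ := Real.Angle.angle_eq_iff_two_pi_dvd_sub.1 c
  have hpi := Real.pi_pos
  have k1 : (k : ℝ) < 1 := by
    by_contra hc
    nlinarith [not_lt.1 hc, a1.1, a1.2]
  have k2 : (-1 : ℝ) < k := by
    by_contra hc
    nlinarith [not_lt.1 hc, a1.1, a1.2]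
  have k0 : k = 0 := by
    have : k < 1 := by exact_mod_cast k1
    have : -1 < k := by exact_mod_cast k2
    omega
  rw [k0] at hk
  simp at hk
  linarith

lemma sum_arg_upper {z : ℕ → ℂ} (n : ℕ) (hz : ∀ i ≤ n, 0 ≤ (z i).im)
    (h : ∀ i < n, 0 < (z (i + 1) / z i).re) :
    ∑ i ∈ Finset.range n, (z (i + 1) / z i).arg = (z n).arg - (z 0).arg := by
  rw [← Finset.sum_range_sub (fun i => (z i).arg) n]
  refine Finset.sum_congr rfl fun i hi => ?_
  have hi' := Finset.mem_range.1 hi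
  exact arg_div_upper (hz i hi'.le) (hz (i + 1) hi') (h i hi')

lemma arg_zero_of {z : ℂ} (h : z.im = 0) (h' : 0 < z.re) : z.arg = 0 :=
  Complex.arg_eq_zero_iff.2 ⟨h'.le, h⟩

lemma arg_pi_of {z : ℂ} (h : z.im = 0) (h' : z.re < 0) : z.arg = Real.pi :=
  Complex.arg_eq_pi_iff.2 ⟨h', h⟩

lemma planar_crossing (p q : ℕ → ℂ) (n m : ℕ) (D : ℝ)
    (hp : ∀ i ≤ n, 0 ≤ (p i).im) (hq : ∀ j ≤ m, 0 ≤ (q j).im)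
    (p0 : (p 0).im = 0) (pn : (p n).im = 0) (q0 : (q 0).im = 0) (qm : (q m).im = 0)
    (h1 : (p 0).re < (q 0).re) (h2 : (q 0).re < (p n).re) (h3 : (p n).re < (q m).re)
    (sp : ∀ i < n, ‖p (i + 1) - p i‖ ≤ D) (sq : ∀ j < m, ‖q (j + 1) - q j‖ ≤ D)
    (far : ∀ i ≤ n, ∀ j ≤ m, D < ‖p i - q j‖) : False := by
  set z : ℕ → ℕ → ℂ := fun i j => p i - q j with hz
  have hA : ∀ i < n, ∀ j ≤ m, 0 < (z (i + 1) j / z i j).re := by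
    intro i hi j hj
    refine re_div_pos (D := D) ?_ (far i hi.le j hj)
    simpa [hz] using sp i hi
  have hB : ∀ i ≤ n, ∀ j < m, 0 < (z i (j + 1) / z i j).re := by
    intro i hi j hj
    refine re_div_pos (D := D) ?_ (far i hi j hj.le)
    have := sq j hj
    rw [norm_sub_rev] at this
    simpa [hz] using this
  have sq4 : ∀ i < n, ∀ j < m, (z (i + 1) (j + 1) / z i (j + 1)).arg - (z (i + 1) j / z i j).arg
      = (z (i + 1) (j + 1) / z (i + 1) j).arg - (z i (j + 1) / z i j).arg := by
    intro i hi j hj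
    have e1 := arg_cocycle (hA i hi j hj.le) (hB (i + 1) hi j hj)
    have e2 := arg_cocycle (hB i hi.le j hj) (hA i hi (j + 1) hj)
    linarith
  have tot : ∑ i ∈ Finset.range n, (z (i + 1) m / z i m).arg
      - ∑ i ∈ Finset.range n, (z (i + 1) 0 / z i 0).arg
      = ∑ j ∈ Finset.range m, ((z n (j + 1) / z n j).arg - (z 0 (j + 1) / z 0 j).arg) := by
    rw [← Finset.sum_range_sub (fun j => ∑ i ∈ Finset.range n, (z (i + 1) j / z i j).arg) m]
    refine Finset.sum_congr rfl fun j hj => ?_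
    have hj' := Finset.mem_range.1 hj
    rw [← Finset.sum_sub_distrib,
      ← Finset.sum_range_sub (fun i => (z i (j + 1) / z i j).arg) n]
    exact Finset.sum_congr rfl fun i hi => sq4 i (Finset.mem_range.1 hi) j hj'
  have s1 : ∑ i ∈ Finset.range n, (z (i + 1) 0 / z i 0).arg = (z n 0).arg - (z 0 0).arg := by
    refine sum_arg_upper (z := fun i => z i 0) n (fun i hi => ?_) (fun i hi => hA i hi 0 (by omega))
    simpa [hz, q0] using hp i hi
  have s2 : ∑ i ∈ Finset.range n, (z (i + 1) m / z i m).arg = (z n m).arg - (z 0 m).arg := by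
    refine sum_arg_upper (z := fun i => z i m) n (fun i hi => ?_) (fun i hi => hA i hi m le_rfl)
    simpa [hz, qm] using hp i hi
  have s3 : ∑ j ∈ Finset.range m, (z n (j + 1) / z n j).arg = (-z n m).arg - (-z n 0).arg := by
    rw [← sum_arg_upper (z := fun j => -z n j) m (fun i hi => ?_) (fun i hi => ?_)]
    · simp only [neg_div_neg_eq]
    · simpa [hz, pn] using hq i hi
    · simpa only [neg_div_neg_eq] using hB n le_rfl i hi
  have s4 : ∑ j ∈ Finset.range m, (z 0 (j + 1) / z 0 j).arg = (-z 0 m).arg - (-z 0 0).arg := by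
    rw [← sum_arg_upper (z := fun j => -z 0 j) m (fun i hi => ?_) (fun i hi => ?_)]
    · simp only [neg_div_neg_eq]
    · simpa [hz, p0] using hq i hi
    · simpa only [neg_div_neg_eq] using hB 0 (by omega) i hi
  rw [Finset.sum_sub_distrib, s1, s2, s3, s4] at tot
  have a1 : (z n 0).arg = 0 := arg_zero_of (by simp [hz, *]) (by simp [hz]; linarith)
  have a2 : (z 0 0).arg = Real.pi := arg_pi_of (by simp [hz, *]) (by simp [hz]; linarith)
  have a3 : (z n m).arg = Real.pi := arg_pi_of (by simp [hz, *]) (by simp [hz]; linarith)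
  have a4 : (z 0 m).arg = Real.pi := arg_pi_of (by simp [hz, *]) (by simp [hz]; linarith)
  have a5 : (-z n m).arg = 0 := arg_zero_of (by simp [hz, *]) (by simp [hz]; linarith)
  have a6 : (-z n 0).arg = Real.pi := arg_pi_of (by simp [hz, *]) (by simp [hz]; linarith)
  have a7 : (-z 0 m).arg = 0 := arg_zero_of (by simp [hz, *]) (by simp [hz]; linarith)
  have a8 : (-z 0 0).arg = 0 := arg_zero_of (by simp [hz, *]) (by simp [hz]; linarith)
  rw [a1, a2, a3, a4, a5, a6, a7, a8] at tot
  linarith [Real.pi_pos]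

end planar
end OWM

namespace OWM

open Relation

/-- symmetrised length -/
noncomputable def ln {G : Type*} [Group G] (nu : G → ℝ) (g : G) : ℝ := max (nu g) (nu g⁻¹)

/-- The features of the ambient group used in the argument. -/
structure Setup (G : Type*) [Group G] [TopologicalSpace G] (nu : G → ℝ) (W : Set G) : Prop where
  nu_mul : ∀ a b, nu (a * b) ≤ nu a + nu b
  isOpen : ∀ R : ℝ, IsOpen {g | ln nu g < R}
  W_conn : IsPreconnected W
  W_one : (1 : G) ∈ W
  W_bdd : ∃ ρ : ℝ, ∀ w ∈ W, ln nu w ≤ ρ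
  cyc : ∀ h : G, ∃ k ∈ W, ∃ x ∈ W, ∃ y ∈ W, h * k * h = x * h⁻¹ * y
  near : ∀ D : ℝ, ∃ ρ : ℝ, ∀ g g' : G, |nu g - nu g'| ≤ D → |nu g⁻¹ - nu g'⁻¹| ≤ D →
    ∃ x y, ln nu x ≤ ρ ∧ ln nu y ≤ ρ ∧ g = x * g' * y

def ProperPair {G : Type*} [Group G] (nu : G → ℝ) (L H : Subgroup G) : Prop :=
  ∀ ρ : ℝ, ∃ T : ℝ, ∀ l ∈ L, ∀ h ∈ H, ∀ x y, ln nu x ≤ ρ → ln nu y ≤ ρ → l = x * h * y →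
    ln nu l ≤ T

/-- cocompactness of a pair of subgroups -/
def CocompactPair {G : Type*} [Group G] (nu : G → ℝ) (L H : Subgroup G) : Prop :=
  ∃ R : ℝ, ∀ g : G, ∃ l ∈ L, ∃ c, ∃ h ∈ H, ln nu c < R ∧ g = l * c * h

section
variable {G : Type*} [Group G] {nu : G → ℝ}

lemma ln_inv (a : G) : ln nu a⁻¹ = ln nu a := by
  simp [ln, max_comm]

lemma nu_le_ln (a : G) : nu a ≤ ln nu a := le_max_left _ _
lemma nu_inv_le_ln (a : G) : nu a⁻¹ ≤ ln nu a := le_max_right _ _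

lemma ln_mul (h : ∀ a b : G, nu (a * b) ≤ nu a + nu b) (a b : G) :
    ln nu (a * b) ≤ ln nu a + ln nu b := by
  refine max_le ((h a b).trans (add_le_add (nu_le_ln a) (nu_le_ln b))) ?_
  rw [_root_.mul_inv_rev]
  refine (h _ _).trans ?_
  linarith [nu_inv_le_ln (nu := nu) a, nu_inv_le_ln (nu := nu) b]

lemma ProperPair.symm (h : ∀ a b : G, nu (a * b) ≤ nu a + nu b) {L H : Subgroup G}
    (hp : ProperPair nu L H) : ProperPair nu H L := by
  intro ρ
  obtain ⟨T, hT⟩ := hp ρ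
  refine ⟨ρ + T + ρ, fun l hl g hg x y hx hy e => ?_⟩
  have := hT g hg l hl x⁻¹ y⁻¹ (by rwa [ln_inv]) (by rwa [ln_inv]) (by rw [e]; group)
  rw [e]
  linarith [ln_mul h (x * g) y, ln_mul h x g]

lemma CocompactPair.symm {L H : Subgroup G}
    (hp : CocompactPair nu L H) : CocompactPair nu H L := by
  obtain ⟨R, hR⟩ := hp
  refine ⟨R, fun g => ?_⟩
  obtain ⟨l, hl, c, h, hh, hc, e⟩ := hR g⁻¹
  refine ⟨h⁻¹, H.inv_mem hh, c⁻¹, l⁻¹, L.inv_mem hl, by rwa [ln_inv], ?_⟩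
  rw [← inv_inv g, e]
  group

/-- Two-ended case. -/
lemma Setup.caseA [TopologicalSpace G] [IsTopologicalGroup G] {W : Set G} (s : Setup G nu W)
    {L H : Subgroup G} {r : ℝ} (hco : Coarse H (fun h => ln nu (h : G)) r)
    (hP : ProperPair nu L H) (hC : CocompactPair nu L H)
    (unb : ∀ T : ℝ, ∃ a : H, T < ln nu (a : G)) (R : ℝ)
    (h2 : ∀ a : H, R < ln nu (a : G) → ¬ Far (fun h : H => ln nu (h : G)) r R a a⁻¹) : False := by
  obtain ⟨S, ⟨Ta, hTa⟩, hb, hc⟩ := hco.two_ended R h2 unb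
  obtain ⟨R0, hR0⟩ := hC
  have lm := ln_mul s.nu_mul
  obtain ⟨ρW, hρW⟩ := s.W_bdd
  -- well-definedness
  obtain ⟨T1, hT1⟩ := hP R0
  have hs : ∀ l ∈ L, ∀ l' ∈ L, ∀ c c' : G, ∀ h h' : H, ln nu c < R0 → ln nu c' < R0 →
      l * c * h = l' * c' * h' → ln nu ((h' * h⁻¹ : H) : G) ≤ T1 + 2 * R0 := by
    intro l hl l' hl' c c' h h' hc hc' e
    have e1 : l'⁻¹ * l = c' * ((h' * h⁻¹ : H) : G) * c⁻¹ := by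
      have : l = l' * c' * h' * (h : G)⁻¹ * c⁻¹ := by rw [← e]; group
      rw [this]; push_cast; group
    have := hT1 (l'⁻¹ * l) (L.mul_mem (L.inv_mem hl') hl) _ (h' * h⁻¹ : H).2 c' c⁻¹ hc'.le
      (by rw [ln_inv]; exact hc.le) e1
    have e2 : ((h' * h⁻¹ : H) : G) = c'⁻¹ * (l'⁻¹ * l) * c := by rw [e1]; group
    rw [e2]
    linarith [lm (c'⁻¹ * (l'⁻¹ * l)) c, lm c'⁻¹ (l'⁻¹ * l), ln_inv (nu := nu) c']
  obtain ⟨T2, hT2⟩ := hb (T1 + 2 * R0)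
  set R3 := max T2 Ta with hR3
  have wd : ∀ l ∈ L, ∀ l' ∈ L, ∀ c c' : G, ∀ h h' : H, ln nu c < R0 → ln nu c' < R0 →
      R3 < ln nu (h : G) → R3 < ln nu (h' : G) →
      l * c * h = l' * c' * h' → (h ∈ S ↔ h' ∈ S) := by
    intro l hl l' hl' c c' h h' hc hc' hh hh' e
    have k := hs l hl l' hl' c c' h h' hc hc' e
    have k1 : Ta < ln nu (h : G) := lt_of_le_of_lt (le_max_right _ _) hh
    have k2 : Ta < ln nu (h' : G) := lt_of_le_of_lt (le_max_right _ _) hh'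
    have k3 : T2 < ln nu (h : G) := lt_of_le_of_lt (le_max_left _ _) hh
    have m1 := hTa h k1
    have m2 := hTa h' k2
    have m3 := hT2 h⁻¹ (h' * h⁻¹)⁻¹ (by simpa [ln_inv] using k3) (by
      have := ln_inv (nu := nu) ((h' * h⁻¹ : H) : G)
      rw [← this] at k
      exact_mod_cast k)
    have e3 : h⁻¹ * (h' * h⁻¹)⁻¹ = h'⁻¹ := by group
    rw [e3] at m3
    tauto
  set P : Set G := {g | ∃ l ∈ L, ∃ c : G, ∃ h : H, ln nu c < R0 ∧ R3 < ln nu (h : G) ∧ h ∈ S ∧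
    g = l * c * h} with hPdef
  set N : Set G := {g | ∃ l ∈ L, ∃ c : G, ∃ h : H, ln nu c < R0 ∧ R3 < ln nu (h : G) ∧ h ∉ S ∧
    g = l * c * h} with hNdef
  have disj : ∀ g, g ∈ P → g ∈ N → False := by
    rintro g ⟨l, hl, c, h, k1, k2, k3, k4⟩ ⟨l', hl', c', h', k1', k2', k3', k4'⟩
    exact k3' ((wd l hl l' hl' c c' h h' k1 k1' k2 k2' (k4.symm.trans k4')).1 k3)
  have openaux : ∀ (Q : H → Prop), IsOpen {g : G | ∃ l ∈ L, ∃ c : G, ∃ h : H, ln nu c < R0 ∧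
      R3 < ln nu (h : G) ∧ Q h ∧ g = l * c * h} := by
    intro Q
    have : {g : G | ∃ l ∈ L, ∃ c : G, ∃ h : H, ln nu c < R0 ∧
      R3 < ln nu (h : G) ∧ Q h ∧ g = l * c * h} = ⋃ l : L, ⋃ h : {h : H // R3 < ln nu (h : G) ∧ Q h},
        (fun g : G => (l : G)⁻¹ * g * ((h : H) : G)⁻¹) ⁻¹' {c | ln nu c < R0} := by
      ext g
      simp only [Set.mem_ofPred_eq, Set.mem_iUnion, Set.mem_preimage]
      constructor
      · rintro ⟨l, hl, c, h, k1, k2, k3, rfl⟩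
        refine ⟨⟨l, hl⟩, ⟨h, k2, k3⟩, ?_⟩
        have : l⁻¹ * (l * c * (h : G)) * (h : G)⁻¹ = c := by group
        simpa only [this] using k1
      · rintro ⟨⟨l, hl⟩, ⟨h, k2, k3⟩, k1⟩
        exact ⟨l, hl, _, h, k1, k2, k3, by group⟩
    rw [this]
    refine isOpen_iUnion fun l => isOpen_iUnion fun h => (s.isOpen R0).preimage ?_
    fun_prop
  have Popen : IsOpen P := openaux (fun h => h ∈ S)
  have Nopen : IsOpen N := openaux (fun h => h ∉ S)
  -- decompositions of x h y are far
  have alpha : ∀ Q : ℝ, ∃ T : ℝ, ∀ h : H, T < ln nu (h : G) → ∀ x ∈ W, ∀ y ∈ W,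
      ∀ l ∈ L, ∀ c : G, ∀ h' : H, ln nu c < R0 → x * h * y = l * c * h' →
      Q < ln nu (h' : G) := by
    intro Q
    obtain ⟨T', hT'⟩ := hP (max ρW (ρW + Q + R0))
    refine ⟨ρW + T' + R0 + Q + ρW, fun h hh x hx y hy l hl c h' hc e => ?_⟩
    by_contra hcon
    have hcon := not_lt.1 hcon
    have e1 : l = x * h * (y * (h' : G)⁻¹ * c⁻¹) := by
      have : l = (l * c * h') * ((h' : G)⁻¹ * c⁻¹) := by group
      rw [this, ← e]; group
    have b1 : ln nu (y * (h' : G)⁻¹ * c⁻¹) ≤ ρW + Q + R0 := by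
      have := lm (y * (h' : G)⁻¹) c⁻¹
      have := lm y (h' : G)⁻¹
      rw [ln_inv] at *
      linarith [hρW y hy]
    have b2 := hT' l hl h h.2 x _ ((hρW x hx).trans (le_max_left _ _))
      (b1.trans (le_max_right _ _)) e1
    have e2 : (h : G) = x⁻¹ * (l * c * h') * y⁻¹ := by rw [← e]; group
    rw [e2] at hh
    have := lm (x⁻¹ * (l * c * h')) y⁻¹
    have := lm x⁻¹ (l * c * h')
    have := lm (l * c) h'
    have := lm l c
    have := hρW x hx
    have := hρW y hy
    rw [ln_inv] at *
    linarith
  obtain ⟨T3, hT3⟩ := alpha R3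
  have cover : ∀ h : H, T3 < ln nu (h : G) → ∀ x ∈ W, ∀ y ∈ W, x * h * y ∈ P ∪ N := by
    intro h hh x hx y hy
    obtain ⟨l, hl, c, h', hh', hc, e⟩ := hR0 (x * h * y)
    have far := hT3 h hh x hx y hy l hl c ⟨h', hh'⟩ hc e
    by_cases hS : (⟨h', hh'⟩ : H) ∈ S
    · exact Or.inl ⟨l, hl, c, ⟨h', hh'⟩, hc, far, hS, e⟩
    · exact Or.inr ⟨l, hl, c, ⟨h', hh'⟩, hc, far, hS, e⟩
  -- base point
  obtain ⟨l0, hl0, c0, h0, hh0, hc0, e0⟩ := hR0 1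
  obtain ⟨T4, hT4⟩ := hb (ln nu h0)
  set T5 := max T4 Ta with hT5
  have left : ∀ h : H, T5 + ln nu h0 < ln nu (h : G) →
      ((⟨h0, hh0⟩ * h : H) ∈ S ↔ h ∈ S) := by
    intro h hh
    have p0 := hco.nonneg ⟨h0, hh0⟩
    have k0 := hco.mul_ge' ⟨h0, hh0⟩ h
    simp only at p0 k0
    have t1 := le_max_left T4 Ta
    have t2 := le_max_right T4 Ta
    have m1 := hTa h (by linarith)
    have m2 := hTa (⟨h0, hh0⟩ * h) (by linarith)
    have m3 := hT4 h⁻¹ (⟨h0, hh0⟩)⁻¹ (by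
      have := hco.inv h
      rw [this]; linarith) (by
      have := hco.inv ⟨h0, hh0⟩
      simp only at this
      rw [this])
    rw [← _root_.mul_inv_rev] at m3
    tauto
  have base : ∀ h : H, T5 + ln nu h0 < ln nu (h : G) → R3 + ln nu h0 < ln nu (h : G) →
      (h ∈ S → (h : G) ∈ P) ∧ (h ∉ S → (h : G) ∈ N) := by
    intro h hh hh'
    have k0 := hco.mul_ge' ⟨h0, hh0⟩ h
    simp only at k0
    have e : (h : G) = l0 * c0 * ((⟨h0, hh0⟩ * h : H) : G) := by
      push_cast
      rw [← mul_assoc, ← e0, one_mul]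
    refine ⟨fun hS => ⟨l0, hl0, c0, _, hc0, by linarith, (left h hh).2 hS, e⟩,
      fun hS => ⟨l0, hl0, c0, _, hc0, by linarith, fun hc => hS ((left h hh).1 hc), e⟩⟩
  have whole : ∃ T : ℝ, ∀ h : H, T < ln nu (h : G) → ∀ x ∈ W, ∀ y ∈ W,
      (h ∈ S → x * h * y ∈ P) ∧ (h ∉ S → x * h * y ∈ N) := by
    refine ⟨max T3 (max (T5 + ln nu h0) (R3 + ln nu h0)), fun h hh x hx y hy => ?_⟩
    have k1 : T3 < ln nu (h : G) := lt_of_le_of_lt (le_max_left _ _) hh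
    have k2 : T5 + ln nu h0 < ln nu (h : G) :=
      lt_of_le_of_lt ((le_max_left _ _).trans (le_max_right _ _)) hh
    have k3 : R3 + ln nu h0 < ln nu (h : G) :=
      lt_of_le_of_lt ((le_max_right _ _).trans (le_max_right _ _)) hh
    have conn : IsPreconnected ((fun p : G × G => p.1 * h * p.2) '' (W ×ˢ W)) := by
      refine (s.W_conn.prod s.W_conn).image _ ?_
      exact Continuous.continuousOn (by fun_prop)
    have sub : ((fun p : G × G => p.1 * h * p.2) '' (W ×ˢ W)) ⊆ P ∪ N := by
      rintro _ ⟨⟨a, b⟩, ⟨ha, hb⟩, rfl⟩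
      exact cover h k1 a ha b hb
    have mh : (h : G) ∈ ((fun p : G × G => p.1 * h * p.2) '' (W ×ˢ W)) :=
      ⟨(1, 1), ⟨s.W_one, s.W_one⟩, by simp⟩
    have mx : x * h * y ∈ ((fun p : G × G => p.1 * h * p.2) '' (W ×ˢ W)) :=
      ⟨(x, y), ⟨hx, hy⟩, rfl⟩
    have dj : Disjoint P N := Set.disjoint_left.2 fun g h1 h2 => disj g h1 h2
    refine ⟨fun hS => ?_, fun hS => ?_⟩
    · exact conn.subset_left_of_subset_union Popen Nopen dj sub ⟨h, mh, (base h k2 k3).1 hS⟩ mx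
    · exact conn.subset_right_of_subset_union Popen Nopen dj sub ⟨h, mh, (base h k2 k3).2 hS⟩ mx
  obtain ⟨T6, hT6⟩ := whole
  obtain ⟨T7, hT7⟩ := hc R3
  obtain ⟨T8, hT8⟩ := alpha (max T7 R3)
  obtain ⟨a, ha⟩ := unb (max (max T6 T7) (max T8 Ta))
  have a6 : T6 < ln nu (a : G) := lt_of_le_of_lt ((le_max_left _ _).trans (le_max_left _ _)) ha
  have a7 : T7 < ln nu (a : G) := lt_of_le_of_lt ((le_max_right _ _).trans (le_max_left _ _)) ha
  have a8 : T8 < ln nu (a : G) := lt_of_le_of_lt ((le_max_left _ _).trans (le_max_right _ _)) ha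
  have a9 : Ta < ln nu (a : G) := lt_of_le_of_lt ((le_max_right _ _).trans (le_max_right _ _)) ha
  clear ha
  have main : ∀ a : H, a ∈ S → T6 < ln nu (a : G) → T7 < ln nu (a : G) → T8 < ln nu (a : G) →
      Ta < ln nu (a : G) → False := by
    intro a aS a6 a7 a8 a9
    obtain ⟨k, hk, x, hx, y, hy, e⟩ := s.cyc (a : G)
    have n1 : x * ((a⁻¹ : H) : G) * y ∈ N := by
      refine (hT6 a⁻¹ ?_ x hx y hy).2 ?_
      · have := hco.inv a
        rwa [this]
      · intro hc
        exact (hTa a a9).1 hc aS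
    have p1 : (a : G) * k ∈ P := by
      have := (hT6 a a6 1 s.W_one k hk).1 aS
      simpa using this
    obtain ⟨l, hl, c, h', hc, k2, k3, e1⟩ := p1
    have f1 := hT8 a a8 1 s.W_one k hk l hl c h' hc (by rw [one_mul, e1])
    have f2 := hT7 h' k3 a aS (lt_of_le_of_lt (le_max_left _ _) f1) a7
    have p2 : (a : G) * k * a ∈ P := by
      refine ⟨l, hl, c, h' * a, hc, f2.2, f2.1, ?_⟩
      rw [e1]; push_cast; group
    rw [e] at p2
    exact disj _ p2 (by simpa using n1)
  by_cases aS : a ∈ S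
  · exact main a aS a6 a7 a8 a9
  · have ei := hco.inv a
    refine main a⁻¹ ((hTa a a9).2 aS) ?_ ?_ ?_ ?_ <;> rw [ei] <;> assumption

end
end OWM

namespace OWM

open Relation

section caseB
variable {G : Type*} [Group G] {nu : G → ℝ}

lemma far_seq {A : Type*} [Group A] {len : A → ℝ} {r R : ℝ} {a b : A} (ha : R < len a)
    (h : Far len r R a b) : ∃ (n : ℕ) (f : ℕ → A), f 0 = a ∧ f n = b ∧
      (∀ i ≤ n, R < len (f i)) ∧ ∀ i < n, len ((f i)⁻¹ * f (i + 1)) ≤ r := by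
  induction h with
  | refl => exact ⟨0, fun _ => a, rfl, rfl, fun _ _ => ha, fun i hi => absurd hi (by omega)⟩
  | @tail b c _ hbc ih =>
    obtain ⟨n, f, h0, hn, h1, h2⟩ := ih
    refine ⟨n + 1, fun i => if i ≤ n then f i else c, by simp [h0], by simp, ?_, ?_⟩
    · intro i hi
      by_cases h : i ≤ n
      · simpa [h] using h1 i h
      · simpa [h] using hbc.2.1
    · intro i hi
      by_cases h : i + 1 ≤ n
      · have h' : i ≤ n := by omega
        simpa [h, h'] using h2 i (by omega)
      · have h' : i = n := by omega
        subst h'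
        simpa [hn] using hbc.2.2

lemma nu_step (hm : ∀ a b : G, nu (a * b) ≤ nu a + nu b) {r : ℝ} {x y : G}
    (h : ln nu (x⁻¹ * y) ≤ r) : |nu y - nu x| ≤ r ∧ |nu y⁻¹ - nu x⁻¹| ≤ r := by
  have h1 := nu_le_ln (nu := nu) (x⁻¹ * y)
  have h2 := nu_inv_le_ln (nu := nu) (x⁻¹ * y)
  have a1 := hm x (x⁻¹ * y)
  have a2 := hm y (x⁻¹ * y)⁻¹
  have a3 := hm (x⁻¹ * y)⁻¹ x⁻¹
  have a4 := hm (x⁻¹ * y) y⁻¹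
  rw [show x * (x⁻¹ * y) = y by group] at a1
  rw [show y * (x⁻¹ * y)⁻¹ = x by group] at a2
  rw [show (x⁻¹ * y)⁻¹ * x⁻¹ = y⁻¹ by group] at a3
  rw [show (x⁻¹ * y) * y⁻¹ = x⁻¹ by group] at a4
  constructor <;> rw [abs_le] <;> constructor <;> linarith

lemma crossing (hm : ∀ a b : G, nu (a * b) ≤ nu a + nu b) {H : Subgroup G} {r R : ℝ}
    {a b : H} (ha : R < ln nu (a : G)) (hab : Far (fun h : H => ln nu (h : G)) r R a b)
    (hr : 0 ≤ r) (va : nu (a : G) - nu (a : G)⁻¹ ≤ 0) (vb : 0 ≤ nu (b : G) - nu (b : G)⁻¹) :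
    ∃ c : H, R < ln nu (c : G) ∧ |nu (c : G) - nu (c : G)⁻¹| ≤ 2 * r := by
  revert vb
  induction hab with
  | refl =>
    intro vb
    exact ⟨a, ha, by rw [le_antisymm va vb]; simpa using hr⟩
  | @tail b c _ hbc ih =>
    intro vc
    by_cases vb : 0 ≤ nu (b : G) - nu (b : G)⁻¹
    · exact ih vb
    · have h3 := hbc.2.2
      simp only [Subgroup.coe_mul, Subgroup.coe_inv] at h3
      obtain ⟨k1, k2⟩ := nu_step hm h3
      refine ⟨c, hbc.2.1, ?_⟩
      rw [abs_le] at *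
      constructor <;> linarith

lemma crossing_far (hm : ∀ a b : G, nu (a * b) ≤ nu a + nu b) {H : Subgroup G} {r : ℝ}
    (hco : Coarse H (fun h => ln nu (h : G)) r) (hr : 0 ≤ r)
    (hB : ∀ R : ℝ, ∃ a : H, R < ln nu (a : G) ∧ Far (fun h : H => ln nu (h : G)) r R a a⁻¹)
    (R : ℝ) : ∃ f : H, ∀ T : ℝ, ∃ c : H, T < ln nu (c : G) ∧
      |nu (c : G) - nu (c : G)⁻¹| ≤ 2 * r ∧ Far (fun h : H => ln nu (h : G)) r R f c := by
  obtain ⟨F, hF, hF'⟩ := hco.finite_far R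
  by_contra hcon
  push Not at hcon
  choose T hT using hcon
  obtain ⟨M, hM⟩ := (hF.image T).bddAbove
  obtain ⟨a, ha, haa⟩ := hB (max M R)
  have : ∃ c : H, max M R < ln nu (c : G) ∧ |nu (c : G) - nu (c : G)⁻¹| ≤ 2 * r := by
    rcases le_total (nu (a : G) - nu (a : G)⁻¹) 0 with h | h
    · refine crossing hm ha haa hr h ?_
      simp only [Subgroup.coe_inv, inv_inv]; linarith
    · have ha' : max M R < ln nu ((a⁻¹ : H) : G) := by
        rw [Subgroup.coe_inv, ln_inv]; exact ha
      refine crossing hm ha' (hco.far_symm haa) hr ?_ h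
      simp only [Subgroup.coe_inv, inv_inv]; linarith
  obtain ⟨c, hc, hv⟩ := this
  obtain ⟨f, hf, hfc⟩ := hF' c (lt_of_le_of_lt (le_max_right _ _) hc)
  have h1 : T f ≤ M := hM ⟨f, hf, rfl⟩
  exact hT f c (lt_of_le_of_lt (h1.trans (le_max_left _ _)) hc) hv hfc

/-- the planar coordinate -/
noncomputable def zc (nu : G → ℝ) (E : ℝ) (g : G) : ℂ :=
  ⟨nu g + nu g⁻¹, max (|nu g - nu g⁻¹| - E) 0⟩

lemma zc_step (hm : ∀ a b : G, nu (a * b) ≤ nu a + nu b) {r E : ℝ} {x y : G}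
    (h : ln nu (x⁻¹ * y) ≤ r) : ‖zc nu E y - zc nu E x‖ ≤ 4 * r := by
  obtain ⟨k1, k2⟩ := nu_step hm h
  refine (Complex.norm_le_abs_re_add_abs_im _).trans ?_
  have e1 : |(zc nu E y - zc nu E x).re| ≤ 2 * r := by
    simp only [zc, Complex.sub_re]
    rw [abs_le] at *
    constructor <;> linarith
  have e2 : |(zc nu E y - zc nu E x).im| ≤ 2 * r := by
    simp only [zc, Complex.sub_im]
    refine (abs_max_sub_max_le_abs _ _ _).trans ?_
    rw [sub_sub_sub_cancel_right]
    refine (abs_abs_sub_abs_le_abs_sub _ _).trans ?_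
    rw [abs_le] at *
    constructor <;> linarith
  linarith

lemma zc_near {E D : ℝ} (hE : 0 ≤ E) {x y : G} (h : ‖zc nu E x - zc nu E y‖ ≤ D) :
    (|nu x - nu y| ≤ D + E ∧ |nu x⁻¹ - nu y⁻¹| ≤ D + E) ∨
    (|nu x - nu y⁻¹| ≤ D + E ∧ |nu x⁻¹ - nu y| ≤ D + E) := by
  have e1 := (Complex.abs_re_le_norm _).trans h
  have e2 := (Complex.abs_im_le_norm _).trans h
  simp only [zc, Complex.sub_re, Complex.sub_im] at e1 e2
  have e3 : |(|nu x - nu x⁻¹| - |nu y - nu y⁻¹|)| ≤ D + E := by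
    have p1 := abs_nonneg (nu x - nu x⁻¹)
    have p2 := abs_nonneg (nu y - nu y⁻¹)
    generalize |nu x - nu x⁻¹| = A at *
    generalize |nu y - nu y⁻¹| = B at *
    rw [abs_le] at *
    rcases max_cases (A - E) 0 with h1 | h1 <;> rcases max_cases (B - E) 0 with h2 | h2 <;>
      constructor <;> linarith
  have hD : 0 ≤ D := (norm_nonneg _).trans h
  rw [abs_le] at e1 e3
  rcases abs_cases (nu x - nu x⁻¹) with h1 | h1 <;>
    rcases abs_cases (nu y - nu y⁻¹) with h2 | h2
  · left; constructor <;> rw [abs_le] <;> constructor <;> linarith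
  · right; constructor <;> rw [abs_le] <;> constructor <;> linarith
  · right; constructor <;> rw [abs_le] <;> constructor <;> linarith
  · left; constructor <;> rw [abs_le] <;> constructor <;> linarith

lemma u_bounds (g : G) : nu g + nu g⁻¹ ≤ 2 * ln nu g ∧
    2 * ln nu g - |nu g - nu g⁻¹| ≤ nu g + nu g⁻¹ := by
  unfold ln
  rcases max_cases (nu g) (nu g⁻¹) with h1 | h1 <;>
    rcases abs_cases (nu g - nu g⁻¹) with h2 | h2 <;> constructor <;> linarith

lemma Setup.caseB [TopologicalSpace G] {W : Set G} (s : Setup G nu W)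
    {L H : Subgroup G} {r : ℝ} (hr : 0 ≤ r) (hcL : Coarse L (fun h => ln nu (h : G)) r)
    (hcH : Coarse H (fun h => ln nu (h : G)) r)
    (hP : ProperPair nu L H)
    (hBL : ∀ R : ℝ, ∃ a : L, R < ln nu (a : G) ∧ Far (fun h : L => ln nu (h : G)) r R a a⁻¹)
    (hBH : ∀ R : ℝ, ∃ a : H, R < ln nu (a : G) ∧ Far (fun h : H => ln nu (h : G)) r R a a⁻¹) :
    False := by
  obtain ⟨ρ, hρ⟩ := s.near (4 * r + 2 * r)
  obtain ⟨R, hR⟩ := hP ρ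
  obtain ⟨fL, hfL⟩ := crossing_far s.nu_mul hcL hr hBL R
  obtain ⟨fH, hfH⟩ := crossing_far s.nu_mul hcH hr hBH R
  obtain ⟨h1, l1, v1, c1⟩ := hfH R
  obtain ⟨g2, l2, v2, c2⟩ := hfL (max R (ln nu (h1 : G) + r))
  obtain ⟨h3, l3, v3, c3⟩ := hfH (ln nu (g2 : G) + r)
  obtain ⟨g4, l4, v4, c4⟩ := hfL (ln nu (h3 : G) + r)
  have l2' := lt_of_le_of_lt (le_max_left _ _) l2
  have l2'' := lt_of_le_of_lt (le_max_right _ _) l2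
  obtain ⟨n, p, p0, pn, pf, ps⟩ :=
    far_seq (len := fun h : H => ln nu (h : G)) l1 (far_trans (hcH.far_symm c1) c3)
  obtain ⟨m, q, q0, qm, qf, qs⟩ :=
    far_seq (len := fun h : L => ln nu (h : G)) l2' (far_trans (hcL.far_symm c2) c4)
  have im0 : ∀ g : G, |nu g - nu g⁻¹| ≤ 2 * r → (zc nu (2 * r) g).im = 0 := by
    intro g hg
    simp only [zc]
    exact max_eq_right (by linarith)
  refine planar_crossing (fun i => zc nu (2 * r) (p i : G)) (fun i => zc nu (2 * r) (q i : G))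
    n m (4 * r) (fun i _ => le_max_right _ _) (fun i _ => le_max_right _ _)
    (by simp only [p0]; exact im0 _ v1) (by simp only [pn]; exact im0 _ v3)
    (by simp only [q0]; exact im0 _ v2) (by simp only [qm]; exact im0 _ v4) ?_ ?_ ?_ ?_ ?_ ?_
  · simp only [p0, q0, zc]
    linarith [(u_bounds (nu := nu) (h1 : G)).1, (u_bounds (nu := nu) (g2 : G)).2]
  · simp only [pn, q0, zc]
    linarith [(u_bounds (nu := nu) (g2 : G)).1, (u_bounds (nu := nu) (h3 : G)).2]
  · simp only [pn, qm, zc]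
    linarith [(u_bounds (nu := nu) (h3 : G)).1, (u_bounds (nu := nu) (g4 : G)).2]
  · intro i hi
    exact zc_step s.nu_mul (by simpa using ps i hi)
  · intro i hi
    exact zc_step s.nu_mul (by simpa using qs i hi)
  · intro i hi j hj
    by_contra hcon
    have hcon := not_lt.1 hcon
    rw [norm_sub_rev] at hcon
    rcases zc_near (by linarith) hcon with ⟨a1, a2⟩ | ⟨a1, a2⟩
    · obtain ⟨x, y, hx, hy, e⟩ := hρ _ _ a1 a2
      exact absurd (hR _ (q j).2 _ (p i).2 x y hx hy e) (not_le.2 (qf j hj))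
    · obtain ⟨x, y, hx, hy, e⟩ := hρ (q j : G) (p i : G)⁻¹ a1 (by simpa using a2)
      exact absurd (hR _ (q j).2 _ (H.inv_mem (p i).2) x y hx hy e) (not_le.2 (qf j hj))

theorem Setup.main [TopologicalSpace G] [IsTopologicalGroup G] {W : Set G} (s : Setup G nu W)
    {L H : Subgroup G} {r : ℝ} (hr : 0 ≤ r) (hcL : Coarse L (fun h => ln nu (h : G)) r)
    (hcH : Coarse H (fun h => ln nu (h : G)) r)
    (hP : ProperPair nu L H) (hC : CocompactPair nu L H) :
    (∃ T : ℝ, ∀ a ∈ L, ln nu a ≤ T) ∨ (∃ T : ℝ, ∀ a ∈ H, ln nu a ≤ T) := by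
  by_contra hcon
  push Not at hcon
  obtain ⟨uL, uH⟩ := hcon
  have uL' : ∀ T : ℝ, ∃ a : L, T < ln nu (a : G) := fun T => by
    obtain ⟨a, h1, h2⟩ := uL T; exact ⟨⟨a, h1⟩, h2⟩
  have uH' : ∀ T : ℝ, ∃ a : H, T < ln nu (a : G) := fun T => by
    obtain ⟨a, h1, h2⟩ := uH T; exact ⟨⟨a, h1⟩, h2⟩
  by_cases hL : ∃ R : ℝ, ∀ a : L, R < ln nu (a : G) →
      ¬ Far (fun h : L => ln nu (h : G)) r R a a⁻¹
  · obtain ⟨R, hR⟩ := hL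
    exact s.caseA hcL (hP.symm s.nu_mul) hC.symm uL' R hR
  by_cases hH : ∃ R : ℝ, ∀ a : H, R < ln nu (a : G) →
      ¬ Far (fun h : H => ln nu (h : G)) r R a a⁻¹
  · obtain ⟨R, hR⟩ := hH
    exact s.caseA hcH hP hC uH' R hR
  push Not at hL hH
  exact s.caseB hr hcL hcH hP hL hH

end caseB
end OWM

namespace OWM

/-- the ambient group -/
abbrev SL3 (𝕂 : Type) [RCLike 𝕂] := Matrix.SpecialLinearGroup (Fin 3) 𝕂

section basic
variable {𝕂 : Type} [RCLike 𝕂]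

lemma isInducing_coe : Topology.IsInducing
    (fun g : SL3 𝕂 => (g : Matrix (Fin 3) (Fin 3) 𝕂)) := ⟨rfl⟩

lemma continuous_coe : Continuous (fun g : SL3 𝕂 => (g : Matrix (Fin 3) (Fin 3) 𝕂)) :=
  isInducing_coe.continuous

instance topGroup : IsTopologicalGroup (SL3 𝕂) where
  continuous_mul := by
    refine isInducing_coe.continuous_iff.2 ?_
    have : ((fun g : SL3 𝕂 => (g : Matrix (Fin 3) (Fin 3) 𝕂)) ∘ fun p : SL3 𝕂 × SL3 𝕂 =>
      p.1 * p.2) = fun p => (p.1 : Matrix (Fin 3) (Fin 3) 𝕂) * (p.2 : Matrix (Fin 3) (Fin 3) 𝕂) := by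
      ext p; simp
    rw [this]
    exact (continuous_coe.comp continuous_fst).matrix_mul (continuous_coe.comp continuous_snd)
  continuous_inv := by
    refine isInducing_coe.continuous_iff.2 ?_
    have : ((fun g : SL3 𝕂 => (g : Matrix (Fin 3) (Fin 3) 𝕂)) ∘ fun p : SL3 𝕂 => p⁻¹)
      = fun p : SL3 𝕂 => (p : Matrix (Fin 3) (Fin 3) 𝕂).adjugate := by
      ext p; simp
    rw [this]
    exact continuous_coe.matrix_adjugate

lemma isClosedEmbedding_coe : Topology.IsClosedEmbedding
    (fun g : SL3 𝕂 => (g : Matrix (Fin 3) (Fin 3) 𝕂)) where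
  toIsInducing := isInducing_coe
  injective := Subtype.coe_injective
  isClosed_range := by
    have : Set.range (fun g : SL3 𝕂 => (g : Matrix (Fin 3) (Fin 3) 𝕂)) = {M | M.det = 1} := by
      ext M
      constructor
      · rintro ⟨g, rfl⟩; exact g.2
      · intro h; exact ⟨⟨M, h⟩, rfl⟩
    rw [this]
    exact isClosed_eq (Continuous.matrix_det continuous_id) continuous_const

/-- entrywise norm -/
noncomputable def nrm (M : Matrix (Fin 3) (Fin 3) 𝕂) : ℝ := ∑ i, ∑ j, ‖M i j‖

lemma nrm_nonneg (M : Matrix (Fin 3) (Fin 3) 𝕂) : 0 ≤ nrm M :=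
  Finset.sum_nonneg fun _ _ => Finset.sum_nonneg fun _ _ => norm_nonneg _

lemma entry_le (M : Matrix (Fin 3) (Fin 3) 𝕂) (i j) : ‖M i j‖ ≤ nrm M :=
  (Finset.single_le_sum (f := fun j => ‖M i j‖) (fun _ _ => norm_nonneg _)
    (Finset.mem_univ j)).trans
  (Finset.single_le_sum (f := fun i => ∑ j, ‖M i j‖)
    (fun _ _ => Finset.sum_nonneg fun _ _ => norm_nonneg _) (Finset.mem_univ i))

lemma nrm_mul (M N : Matrix (Fin 3) (Fin 3) 𝕂) : nrm (M * N) ≤ nrm M * nrm N := by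
  have h : ∀ i j, ‖(M * N) i j‖ ≤ ∑ k, ‖M i k‖ * ‖N k j‖ := fun i j => by
    rw [Matrix.mul_apply]
    exact (norm_sum_le _ _).trans (Finset.sum_le_sum fun k _ => norm_mul_le _ _)
  have h2 : ∀ k, ∑ j, ‖N k j‖ ≤ nrm N := fun k =>
    Finset.single_le_sum (f := fun i => ∑ j, ‖N i j‖)
    (fun _ _ => Finset.sum_nonneg fun _ _ => norm_nonneg _) (Finset.mem_univ k)
  calc nrm (M * N) ≤ ∑ i, ∑ j, ∑ k, ‖M i k‖ * ‖N k j‖ :=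
        Finset.sum_le_sum fun i _ => Finset.sum_le_sum fun j _ => h i j
    _ = ∑ i, ∑ k, ‖M i k‖ * ∑ j, ‖N k j‖ := by
        refine Finset.sum_congr rfl fun i _ => ?_
        rw [Finset.sum_comm]
        simp_rw [Finset.mul_sum]
    _ ≤ ∑ i, ∑ k, ‖M i k‖ * nrm N := Finset.sum_le_sum fun i _ => Finset.sum_le_sum fun k _ =>
        mul_le_mul_of_nonneg_left (h2 k) (norm_nonneg _)
    _ = nrm M * nrm N := by simp_rw [nrm, Finset.sum_mul]

lemma continuous_nrm : Continuous (nrm : Matrix (Fin 3) (Fin 3) 𝕂 → ℝ) := by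
  unfold nrm
  refine continuous_finsetSum _ fun i _ => continuous_finsetSum _ fun j _ => ?_
  exact (continuous_id.matrix_elem i j).norm

lemma nrm_pos (g : SL3 𝕂) : 0 < nrm (g : Matrix (Fin 3) (Fin 3) 𝕂) := by
  refine lt_of_le_of_ne (nrm_nonneg _) fun h => ?_
  have : (g : Matrix (Fin 3) (Fin 3) 𝕂) = 0 := by
    ext i j
    have := entry_le (g : Matrix (Fin 3) (Fin 3) 𝕂) i j
    rw [← h] at this
    simpa using this
  have h1 := g.2
  rw [this] at h1
  simp at h1

/-- logarithmic size -/
noncomputable def nu (g : SL3 𝕂) : ℝ := Real.log (nrm (g : Matrix (Fin 3) (Fin 3) 𝕂))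

lemma nu_mul (a b : SL3 𝕂) : nu (a * b) ≤ nu a + nu b := by
  unfold nu
  rw [← Real.log_mul (nrm_pos a).ne' (nrm_pos b).ne']
  refine Real.log_le_log (nrm_pos _) ?_
  rw [Matrix.SpecialLinearGroup.coe_mul]
  exact nrm_mul _ _

lemma continuous_nu : Continuous (nu : SL3 𝕂 → ℝ) :=
  (continuous_nrm.comp continuous_coe).log fun g => (nrm_pos g).ne'

lemma continuous_ln : Continuous (ln nu : SL3 𝕂 → ℝ) :=
  continuous_nu.max (continuous_nu.comp continuous_inv)

lemma isOpen_ball (R : ℝ) : IsOpen {g : SL3 𝕂 | ln nu g < R} :=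
  isOpen_lt continuous_ln continuous_const

lemma isClosed_ball (R : ℝ) : IsClosed {g : SL3 𝕂 | ln nu g ≤ R} :=
  isClosed_le continuous_ln continuous_const

lemma isCompact_box (C : ℝ) : IsCompact {M : Matrix (Fin 3) (Fin 3) 𝕂 | ∀ i j, ‖M i j‖ ≤ C} := by
  have : {M : Matrix (Fin 3) (Fin 3) 𝕂 | ∀ i j, ‖M i j‖ ≤ C} =
      Set.pi Set.univ (fun _ : Fin 3 => Set.pi Set.univ fun _ : Fin 3 =>
        Metric.closedBall (0 : 𝕂) C) := by
    ext M
    simp only [Set.mem_ofPred_eq]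
    constructor
    · intro h i _ j _
      simpa using h i j
    · intro h i j
      simpa using h i trivial j trivial
  rw [this]
  exact isCompact_univ_pi fun _ => isCompact_univ_pi fun _ => isCompact_closedBall _ _

lemma isCompact_bdd {S : Set (SL3 𝕂)} (hS : IsClosed S) (C : ℝ)
    (h : ∀ g ∈ S, ∀ i j, ‖(g : Matrix (Fin 3) (Fin 3) 𝕂) i j‖ ≤ C) : IsCompact S :=
  (isClosedEmbedding_coe.isCompact_preimage (isCompact_box C)).of_isClosed_subset hS h

lemma isCompact_of_ln {S : Set (SL3 𝕂)} (hS : IsClosed S) (R : ℝ)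
    (h : ∀ g ∈ S, ln nu g ≤ R) : IsCompact S := by
  refine isCompact_bdd hS (Real.exp R) fun g hg i j => (entry_le _ i j).trans ?_
  rw [← Real.log_le_iff_le_exp (nrm_pos g)]
  exact (nu_le_ln g).trans (h g hg)

lemma isCompact_ball (R : ℝ) : IsCompact {g : SL3 𝕂 | ln nu g ≤ R} :=
  isCompact_of_ln (isClosed_ball R) R fun _ h => h

lemma compact_bdd {S : Set (SL3 𝕂)} (hS : IsCompact S) : ∃ R : ℝ, ∀ g ∈ S, ln nu g ≤ R := by
  obtain ⟨R, hR⟩ := hS.bddAbove_image continuous_ln.continuousOn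
  exact ⟨R, fun g hg => hR ⟨g, hg, rfl⟩⟩

lemma ln_one_lt : ln nu (1 : SL3 𝕂) < 2 := by
  have : nrm (1 : Matrix (Fin 3) (Fin 3) 𝕂) = 3 := by
    simp [nrm, Fin.sum_univ_three, Matrix.one_apply]; norm_num
  unfold ln nu
  rw [inv_one, max_self, Matrix.SpecialLinearGroup.coe_one, this,
    Real.log_lt_iff_lt_exp (by norm_num)]
  have := Real.add_one_lt_exp (x := 2) (by norm_num)
  linarith

/-- finite nets in subgroups -/
lemma net (H : Subgroup (SL3 𝕂)) (R : ℝ) : ∃ F : Set H, F.Finite ∧ ∀ a : H,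
    ln nu (a : SL3 𝕂) ≤ R → ∃ f ∈ F, ln nu ((f⁻¹ * a : H) : SL3 𝕂) ≤ 4 := by
  have hc := isCompact_ball (𝕂 := 𝕂) R
  obtain ⟨t, ht⟩ := hc.elim_finite_subcover (fun f : SL3 𝕂 => {g : SL3 𝕂 | ln nu (f⁻¹ * g) < 2})
    (fun f => (isOpen_ball 2).preimage (continuous_const_mul _)) (by
      intro g _
      refine Set.mem_iUnion.2 ⟨g, ?_⟩
      change ln nu (g⁻¹ * g) < 2
      rw [inv_mul_cancel]
      exact ln_one_lt)
  classical
  let φ : SL3 𝕂 → H := fun f => if h : ∃ a : H, ln nu (f⁻¹ * (a : SL3 𝕂)) < 2 then h.choose else 1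
  refine ⟨φ '' t, (Finset.finite_toSet t).image _, fun a ha => ?_⟩
  obtain ⟨f, hf⟩ := Set.mem_iUnion.1 (ht ha)
  obtain ⟨hft, hfa⟩ := Set.mem_iUnion.1 hf
  change ln nu (f⁻¹ * (a : SL3 𝕂)) < 2 at hfa
  refine ⟨φ f, ⟨f, hft, rfl⟩, ?_⟩
  have h : ∃ a : H, ln nu (f⁻¹ * (a : SL3 𝕂)) < 2 := ⟨a, hfa⟩
  have e : φ f = h.choose := dif_pos h
  have h3 := h.choose_spec
  rw [← e] at h3
  have e2 : ((φ f : SL3 𝕂))⁻¹ * (a : SL3 𝕂) = (f⁻¹ * φ f)⁻¹ * (f⁻¹ * a) := by group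
  rw [Subgroup.coe_mul, Subgroup.coe_inv, e2]
  have := ln_mul nu_mul (f⁻¹ * φ f : SL3 𝕂)⁻¹ (f⁻¹ * a)
  rw [ln_inv] at this
  linarith

/-- chains from bounded generators -/
lemma gen_of_closure {H : Subgroup (SL3 𝕂)} {r : ℝ} (S : Set H)
    (hS : ∀ s ∈ S, ln nu (s : SL3 𝕂) ≤ r) (hcl : Subgroup.closure S = ⊤) (a : H) :
    Relation.ReflTransGen (fun x y : H => ln nu ((x⁻¹ * y : H) : SL3 𝕂) ≤ r) 1 a := by
  have ha : a ∈ Subgroup.closure S := by rw [hcl]; trivial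
  induction ha using Subgroup.closure_induction_right with
  | one => exact Relation.ReflTransGen.refl
  | mul_right x hx y hy ih =>
    refine ih.tail ?_
    rw [inv_mul_cancel_left]
    exact hS y hy
  | mul_inv_cancel x hx y hy ih =>
    refine ih.tail ?_
    rw [inv_mul_cancel_left, Subgroup.coe_inv, ln_inv]
    exact hS y hy

lemma coarse_of_closure {H : Subgroup (SL3 𝕂)} {r : ℝ} (hr : 8 ≤ r) (S : Set H)
    (hS : ∀ s ∈ S, ln nu (s : SL3 𝕂) ≤ r) (hcl : Subgroup.closure S = ⊤) :
    Coarse H (fun h => ln nu (h : SL3 𝕂)) r where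
  mul a b := by
    rw [Subgroup.coe_mul]; exact ln_mul nu_mul _ _
  inv a := by rw [Subgroup.coe_inv, ln_inv]
  gen a := gen_of_closure S hS hcl a
  net R := by
    obtain ⟨F, hF, h⟩ := net H R
    refine ⟨F, hF, fun a ha => ?_⟩
    obtain ⟨f, hf, h'⟩ := h a ha
    exact ⟨f, hf, h'.trans (by linarith)⟩

lemma closure_of_connected (H : Subgroup (SL3 𝕂)) (hc : IsPreconnected (H : Set (SL3 𝕂))) :
    Subgroup.closure {s : H | ln nu (s : SL3 𝕂) < 2} = ⊤ := by
  have : PreconnectedSpace H := Subtype.preconnectedSpace hc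
  have ho : IsOpen ({s : H | ln nu (s : SL3 𝕂) < 2}) :=
    (isOpen_ball 2).preimage continuous_subtype_val
  have h1 : IsOpen ((Subgroup.closure {s : H | ln nu (s : SL3 𝕂) < 2} : Subgroup H) : Set H) := by
    refine Subgroup.isOpen_of_mem_nhds _ (g := 1) ?_
    refine Filter.mem_of_superset (ho.mem_nhds ?_) Subgroup.subset_closure
    exact ln_one_lt
  have h2 := Subgroup.isClosed_of_isOpen _ h1
  have := IsClopen.eq_univ ⟨h2, h1⟩ ⟨1, Subgroup.one_mem _⟩
  exact SetLike.coe_injective this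

end basic
end OWM

namespace OWM

section actions
variable {𝕂 : Type} [RCLike 𝕂]

lemma properPair_of (H Γ : Subgroup (SL3 𝕂))
    (hpd : ∀ K L : Set (SL3 𝕂 ⧸ H), IsCompact K → IsCompact L →
        {γ : Γ | ∃ x ∈ K, ((γ : SL3 𝕂) • x) ∈ L}.Finite) : ProperPair nu Γ H := by
  intro ρ
  have hK : IsCompact ((QuotientGroup.mk : SL3 𝕂 → SL3 𝕂 ⧸ H) '' {g | ln nu g ≤ ρ}) :=
    (isCompact_ball ρ).image continuous_quotient_mk'
  obtain ⟨T, hT⟩ := ((hpd _ _ hK hK).image (fun γ : Γ => ln nu (γ : SL3 𝕂))).bddAbove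
  refine ⟨T, fun l hl h hh x y hx hy e => ?_⟩
  refine hT ⟨⟨l, hl⟩, ?_, rfl⟩
  refine ⟨QuotientGroup.mk y⁻¹, ⟨y⁻¹, by simpa [ln_inv] using hy, rfl⟩, x, hx, ?_⟩
  change QuotientGroup.mk x = QuotientGroup.mk (l * y⁻¹)
  rw [QuotientGroup.eq, e]
  have : x⁻¹ * (x * h * y * y⁻¹) = h := by group
  rw [this]
  exact hh

lemma cocompactPair_of (H Γ : Subgroup (SL3 𝕂))
    (hco : ∃ K : Set (SL3 𝕂 ⧸ H), IsCompact K ∧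
        ∀ x : SL3 𝕂 ⧸ H, ∃ γ ∈ Γ, ∃ y ∈ K, γ • y = x) : CocompactPair nu Γ H := by
  obtain ⟨K, hK, h⟩ := hco
  obtain ⟨n, hn⟩ := hK.elim_directed_cover
    (fun n : ℕ => (QuotientGroup.mk : SL3 𝕂 → SL3 𝕂 ⧸ H) '' {g | ln nu g < n})
    (fun n => QuotientGroup.isOpenMap_coe _ (isOpen_ball _)) (by
      intro x _
      obtain ⟨g, rfl⟩ := QuotientGroup.mk_surjective x
      obtain ⟨n, hn⟩ := exists_nat_gt (ln nu g)
      exact Set.mem_iUnion.2 ⟨n, g, hn, rfl⟩) (by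
      refine directed_of_isDirected_le ?_
      intro n m hnm
      refine Set.image_mono ?_
      intro g hg
      exact lt_of_lt_of_le (show ln nu g < (n : ℝ) from hg) (by exact_mod_cast hnm))
  refine ⟨n, fun g => ?_⟩
  obtain ⟨γ, hγ, y, hy, e⟩ := h (QuotientGroup.mk g)
  obtain ⟨c, hc, rfl⟩ := hn hy
  have e' : (QuotientGroup.mk (γ * c) : SL3 𝕂 ⧸ H) = QuotientGroup.mk g := e
  rw [QuotientGroup.eq] at e'
  exact ⟨γ, hγ, c, _, e', hc, by group⟩

lemma gamma_gen [PreconnectedSpace (SL3 𝕂)] {H Γ : Subgroup (SL3 𝕂)}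
    (hP : ProperPair nu Γ H) (hC : CocompactPair nu Γ H) :
    ∃ (T : ℝ) (S : Set Γ), (∀ s ∈ S, ln nu (s : SL3 𝕂) ≤ T) ∧ Subgroup.closure S = ⊤ := by
  obtain ⟨R, hR⟩ := hC
  obtain ⟨T, hT⟩ := hP R
  refine ⟨T, {s : Γ | ∃ c c', ∃ h ∈ H, ln nu c < R ∧ ln nu c' < R ∧ (s : SL3 𝕂) = c' * h * c⁻¹},
    ?_, ?_⟩
  · rintro s ⟨c, c', h, hh, hc, hc', e⟩
    exact hT s s.2 h hh c' c⁻¹ hc'.le (by rw [ln_inv]; exact hc.le) e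
  set Γ' := Subgroup.closure {s : Γ | ∃ c c', ∃ h ∈ H, ln nu c < R ∧ ln nu c' < R ∧
    (s : SL3 𝕂) = c' * h * c⁻¹} with hΓ'
  have openaux : ∀ (Q : Γ → Prop), IsOpen {g : SL3 𝕂 | ∃ l : Γ, ∃ c : SL3 𝕂, ∃ h : H,
      ln nu c < R ∧ Q l ∧ g = l * c * h} := by
    intro Q
    have : {g : SL3 𝕂 | ∃ l : Γ, ∃ c : SL3 𝕂, ∃ h : H, ln nu c < R ∧ Q l ∧ g = l * c * h} =
        ⋃ l : {l : Γ // Q l}, ⋃ h : H,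
        (fun g : SL3 𝕂 => ((l : Γ) : SL3 𝕂)⁻¹ * g * (h : SL3 𝕂)⁻¹) ⁻¹' {c | ln nu c < R} := by
      ext g
      simp only [Set.mem_ofPred_eq, Set.mem_iUnion, Set.mem_preimage]
      constructor
      · rintro ⟨l, c, h, k1, k2, rfl⟩
        refine ⟨⟨l, k2⟩, h, ?_⟩
        have : (l : SL3 𝕂)⁻¹ * (l * c * (h : SL3 𝕂)) * (h : SL3 𝕂)⁻¹ = c := by group
        simpa only [this] using k1
      · rintro ⟨⟨l, hl⟩, h, k1⟩
        exact ⟨l, _, h, k1, hl, by group⟩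
    rw [this]
    refine isOpen_iUnion fun l => isOpen_iUnion fun h => (isOpen_ball R).preimage ?_
    exact (continuous_const.mul continuous_id).mul continuous_const
  by_contra hne
  have : ∃ γ : Γ, γ ∉ Γ' := by
    by_contra hcon
    push Not at hcon
    exact hne (eq_top_iff.2 fun x _ => hcon x)
  obtain ⟨γ, hγ⟩ := this
  obtain ⟨_, _, c0, _, _, hc0, _⟩ := hR 1
  obtain ⟨g, -, ⟨l, c, h, k1, k2, k3⟩, ⟨l', c', h', k1', k2', k3'⟩⟩ :=
    (isPreconnected_univ : IsPreconnected (Set.univ : Set (SL3 𝕂))) _ _ (openaux (fun l => l ∈ Γ'))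
    (openaux (fun l => l ∉ Γ')) (by
      intro g _
      obtain ⟨l, hl, c, h, hh, hc, e⟩ := hR g
      by_cases hl' : (⟨l, hl⟩ : Γ) ∈ Γ'
      · exact Or.inl ⟨⟨l, hl⟩, c, ⟨h, hh⟩, hc, hl', e⟩
      · exact Or.inr ⟨⟨l, hl⟩, c, ⟨h, hh⟩, hc, hl', e⟩)
    ⟨c0, trivial, 1, c0, 1, hc0, Γ'.one_mem, by simp⟩
    ⟨γ * c0, trivial, γ, c0, 1, hc0, hγ, by simp⟩
  apply k2'
  have : l⁻¹ * l' ∈ Γ' := by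
    refine Subgroup.subset_closure ⟨c', c, h * (h' : SL3 𝕂)⁻¹, H.mul_mem h.2 (H.inv_mem h'.2),
      k1', k1, ?_⟩
    have e : (l' : SL3 𝕂) = l * c * h * (h' : SL3 𝕂)⁻¹ * c'⁻¹ := by rw [← k3, k3']; group
    rw [Subgroup.coe_mul, Subgroup.coe_inv, e]
    group
  have h2 := Γ'.mul_mem k2 this
  rwa [mul_inv_cancel_left] at h2

theorem final_of [PreconnectedSpace (SL3 𝕂)] {W : Set (SL3 𝕂)} (s : Setup (SL3 𝕂) nu W)
    (H Γ : Subgroup (SL3 𝕂)) (hclosed : IsClosed (H : Set (SL3 𝕂)))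
    (hconn : IsConnected (H : Set (SL3 𝕂)))
    (hpd : ∀ K L : Set (SL3 𝕂 ⧸ H), IsCompact K → IsCompact L →
        {γ : Γ | ∃ x ∈ K, ((γ : SL3 𝕂) • x) ∈ L}.Finite)
    (hco : ∃ K : Set (SL3 𝕂 ⧸ H), IsCompact K ∧
        ∀ x : SL3 𝕂 ⧸ H, ∃ γ ∈ Γ, ∃ y ∈ K, γ • y = x) :
    IsCompact (H : Set (SL3 𝕂)) ∨ CompactSpace (SL3 𝕂 ⧸ H) := by
  have hP := properPair_of H Γ hpd
  have hC := cocompactPair_of H Γ hco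
  obtain ⟨T, S, hS, hcl⟩ := gamma_gen hP hC
  have cΓ := coarse_of_closure (r := max 8 T) (le_max_left _ _) S
    (fun s hs => (hS s hs).trans (le_max_right _ _)) hcl
  have cH := coarse_of_closure (r := max 8 T) (le_max_left _ _)
    {s : H | ln nu (s : SL3 𝕂) < 2} (fun s hs => (le_of_lt hs).trans
      (le_max_of_le_left (by norm_num))) (closure_of_connected H hconn.isPreconnected)
  rcases s.main (le_max_of_le_left (by norm_num)) cΓ cH hP hC with ⟨T, hT⟩ | ⟨T, hT⟩
  · right
    obtain ⟨R, hR⟩ := hC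
    have hK : IsCompact ((QuotientGroup.mk : SL3 𝕂 → SL3 𝕂 ⧸ H) '' {g | ln nu g ≤ T + R}) :=
      (isCompact_ball _).image continuous_quotient_mk'
    refine ⟨?_⟩
    convert hK
    symm
    refine Set.eq_univ_of_forall fun x => ?_
    obtain ⟨g, rfl⟩ := QuotientGroup.mk_surjective x
    obtain ⟨l, hl, c, h, hh, hc, e⟩ := hR g
    refine ⟨l * c, ?_, ?_⟩
    · change ln nu (l * c) ≤ T + R
      linarith [hT l hl, ln_mul nu_mul l c]
    · rw [QuotientGroup.eq, e]
      have : (l * c)⁻¹ * (l * c * h) = h := by group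
      rwa [this]
  · left
    exact isCompact_of_ln hclosed T hT

end actions
end OWM

namespace OWM

section svd
open scoped ComplexOrder
variable {𝕂 : Type} [RCLike 𝕂]

/-- the special unitary (orthogonal) subgroup -/
def KK (𝕂 : Type) [RCLike 𝕂] : Subgroup (SL3 𝕂) where
  carrier := {g | (g : Matrix (Fin 3) (Fin 3) 𝕂) ∈ Matrix.unitaryGroup (Fin 3) 𝕂}
  mul_mem' {a b} ha hb := by
    change ((a * b : SL3 𝕂) : Matrix (Fin 3) (Fin 3) 𝕂) ∈ Matrix.unitaryGroup (Fin 3) 𝕂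
    rw [Matrix.SpecialLinearGroup.coe_mul]
    exact mul_mem ha hb
  one_mem' := by
    change ((1 : SL3 𝕂) : Matrix (Fin 3) (Fin 3) 𝕂) ∈ Matrix.unitaryGroup (Fin 3) 𝕂
    rw [Matrix.SpecialLinearGroup.coe_one]
    exact one_mem _
  inv_mem' {a} ha := by
    change ((a⁻¹ : SL3 𝕂) : Matrix (Fin 3) (Fin 3) 𝕂) ∈ Matrix.unitaryGroup (Fin 3) 𝕂
    have h1 : (a : Matrix (Fin 3) (Fin 3) 𝕂) * star (a : Matrix (Fin 3) (Fin 3) 𝕂) = 1 := ha.2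
    have h2 : ((a⁻¹ : SL3 𝕂) : Matrix (Fin 3) (Fin 3) 𝕂) * (a : Matrix (Fin 3) (Fin 3) 𝕂) = 1 := by
      rw [← Matrix.SpecialLinearGroup.coe_mul, inv_mul_cancel, Matrix.SpecialLinearGroup.coe_one]
    rw [left_inv_eq_right_inv h2 h1]
    exact Unitary.star_mem ha

lemma mem_KK {g : SL3 𝕂} :
    g ∈ KK 𝕂 ↔ (g : Matrix (Fin 3) (Fin 3) 𝕂) ∈ Matrix.unitaryGroup (Fin 3) 𝕂 := Iff.rfl

lemma nu_KK {g : SL3 𝕂} (h : g ∈ KK 𝕂) : nu g ≤ Real.log 9 := by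
  refine Real.log_le_log (nrm_pos g) ?_
  have : ∀ i j, ‖(g : Matrix (Fin 3) (Fin 3) 𝕂) i j‖ ≤ 1 := fun i j =>
    entry_norm_bound_of_unitary h i j
  calc nrm (g : Matrix (Fin 3) (Fin 3) 𝕂) ≤ ∑ i : Fin 3, ∑ j : Fin 3, (1 : ℝ) :=
        Finset.sum_le_sum fun i _ => Finset.sum_le_sum fun j _ => this i j
    _ = 9 := by norm_num

lemma ln_KK {g : SL3 𝕂} (h : g ∈ KK 𝕂) : ln nu g ≤ Real.log 9 :=
  max_le (nu_KK h) (nu_KK ((KK 𝕂).inv_mem h))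

/-- the diagonal torus -/
noncomputable def ex (𝕂 : Type) [RCLike 𝕂] (x y : ℝ) : SL3 𝕂 :=
  ⟨Matrix.diagonal ![((Real.exp x : ℝ) : 𝕂), ((Real.exp (-x - y) : ℝ) : 𝕂),
    ((Real.exp y : ℝ) : 𝕂)], by
    rw [Matrix.det_diagonal, Fin.prod_univ_three]
    simp only [Matrix.cons_val]
    rw [← RCLike.ofReal_mul, ← RCLike.ofReal_mul, ← Real.exp_add, ← Real.exp_add]
    rw [show x + (-x - y) + y = 0 by ring]
    simp⟩

lemma ex_coe (x y : ℝ) : ((ex 𝕂 x y : SL3 𝕂) : Matrix (Fin 3) (Fin 3) 𝕂) =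
  Matrix.diagonal ![((Real.exp x : ℝ) : 𝕂), ((Real.exp (-x - y) : ℝ) : 𝕂),
    ((Real.exp y : ℝ) : 𝕂)] := rfl

lemma ex_mul (x y x' y' : ℝ) : ex 𝕂 x y * ex 𝕂 x' y' = ex 𝕂 (x + x') (y + y') := by
  apply Subtype.ext
  rw [Matrix.SpecialLinearGroup.coe_mul, ex_coe, ex_coe, ex_coe, Matrix.diagonal_mul_diagonal]
  congr 1
  ext i
  fin_cases i
  · simp [Real.exp_add]
  · simp only [Fin.mk_one, Matrix.cons_val_one, Matrix.cons_val_zero]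
    rw [← RCLike.ofReal_mul, ← Real.exp_add]
    congr 2; ring
  · simp [Real.exp_add]

lemma ex_zero : ex 𝕂 0 0 = 1 := by
  apply Subtype.ext
  rw [ex_coe, Matrix.SpecialLinearGroup.coe_one, ← Matrix.diagonal_one]
  congr 1
  ext i
  fin_cases i <;> simp

lemma ex_inv (x y : ℝ) : (ex 𝕂 x y)⁻¹ = ex 𝕂 (-x) (-y) := by
  rw [inv_eq_iff_mul_eq_one, ex_mul]
  simp [ex_zero]

lemma nrm_ex (x y : ℝ) : nrm ((ex 𝕂 x y : SL3 𝕂) : Matrix (Fin 3) (Fin 3) 𝕂) =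
    Real.exp x + Real.exp (-x - y) + Real.exp y := by
  rw [ex_coe]
  simp [nrm, Fin.sum_univ_three, Matrix.diagonal_apply, abs_of_pos, Real.exp_pos]

lemma nu_ex_le {x y C : ℝ} (h1 : x ≤ C) (h2 : -x - y ≤ C) (h3 : y ≤ C) :
    nu (ex 𝕂 x y) ≤ Real.log 3 + C := by
  unfold nu
  rw [Real.log_le_iff_le_exp (nrm_pos _), nrm_ex, Real.exp_add, Real.exp_log (by norm_num)]
  have := Real.exp_le_exp.2 h1
  have := Real.exp_le_exp.2 h2
  have := Real.exp_le_exp.2 h3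
  linarith

lemma le_nu_ex (x y : ℝ) : x ≤ nu (ex 𝕂 x y) ∧ y ≤ nu (ex 𝕂 x y) := by
  unfold nu
  rw [Real.le_log_iff_exp_le (nrm_pos _), Real.le_log_iff_exp_le (nrm_pos _), nrm_ex]
  have := Real.exp_pos x
  have := Real.exp_pos y
  have := Real.exp_pos (-x - y)
  constructor <;> linarith

lemma posDef_self (g : SL3 𝕂) : ((g : Matrix (Fin 3) (Fin 3) 𝕂)ᴴ *
    (g : Matrix (Fin 3) (Fin 3) 𝕂)).PosDef := by
  refine Matrix.PosDef.conjTranspose_mul_self _ ?_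
  refine Matrix.mulVec_injective_of_isUnit ?_
  rw [Matrix.isUnit_iff_isUnit_det, g.2]
  exact isUnit_one

/-- sorted spectral decomposition -/
lemma spectral (g : SL3 𝕂) : ∃ (U : Matrix (Fin 3) (Fin 3) 𝕂) (l : Fin 3 → ℝ),
    star U * U = 1 ∧ (∀ i, 0 < l i) ∧ l 1 ≤ l 0 ∧ l 2 ≤ l 1 ∧
    star U * ((g : Matrix (Fin 3) (Fin 3) 𝕂)ᴴ * (g : Matrix (Fin 3) (Fin 3) 𝕂)) * U
      = Matrix.diagonal (fun i => (l i : 𝕂)) := by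
  have hp := posDef_self g
  set A := (g : Matrix (Fin 3) (Fin 3) 𝕂)ᴴ * (g : Matrix (Fin 3) (Fin 3) 𝕂)
  have hA := hp.isHermitian
  set σ := Tuple.sort (fun i => - hA.eigenvalues i) with hσ
  have mono := Tuple.monotone_sort (fun i => - hA.eigenvalues i)
  set V : Matrix (Fin 3) (Fin 3) 𝕂 := (hA.eigenvectorUnitary : Matrix (Fin 3) (Fin 3) 𝕂)
  have hV : star V * V = 1 := hA.eigenvectorUnitary.2.1
  have hs : star V * A * V = Matrix.diagonal (fun i => (hA.eigenvalues i : 𝕂)) := by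
    have := hA.conjStarAlgAut_star_eigenvectorUnitary
    rw [Unitary.conjStarAlgAut_star_apply] at this
    exact this
  refine ⟨V.submatrix id σ, fun i => hA.eigenvalues (σ i), ?_, fun i => hp.eigenvalues_pos _,
    ?_, ?_, ?_⟩
  · have : (star V * V).submatrix σ σ = 1 := by rw [hV]; simp
    rw [← this]
    ext i j
    simp [Matrix.mul_apply, Matrix.star_apply]
  · have := mono (show (0 : Fin 3) ≤ 1 by decide)
    simpa using this
  · have := mono (show (1 : Fin 3) ≤ 2 by decide)
    simpa using this
  · have : (star V * A * V).submatrix σ σ =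
        Matrix.diagonal (fun i => (hA.eigenvalues (σ i) : 𝕂)) := by
      rw [hs]
      exact Matrix.submatrix_diagonal_equiv _ _
    rw [← this]
    ext i j
    simp [Matrix.mul_apply, Matrix.star_apply]

end svd
end OWM

namespace OWM

section svd2
variable {𝕂 : Type} [RCLike 𝕂]

lemma svd (g : SL3 𝕂) : ∃ u ∈ KK 𝕂, ∃ v ∈ KK 𝕂, ∃ x y : ℝ, y ≤ -x - y ∧ -x - y ≤ x ∧
    g = u * ex 𝕂 x y * v := by
  obtain ⟨U, l, hU, hl, h01, h12, hd⟩ := spectral g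
  set M := (g : Matrix (Fin 3) (Fin 3) 𝕂) with hM
  have hU' : U * star U = 1 := mul_eq_one_comm.1 hU
  set d : Fin 3 → ℝ := fun i => Real.sqrt (l i) with hdd
  have dpos : ∀ i, 0 < d i := fun i => Real.sqrt_pos.2 (hl i)
  have dsq : ∀ i, d i * d i = l i := fun i => Real.mul_self_sqrt (hl i).le
  set D : Matrix (Fin 3) (Fin 3) 𝕂 := Matrix.diagonal (fun i => (d i : 𝕂)) with hD
  set Di : Matrix (Fin 3) (Fin 3) 𝕂 := Matrix.diagonal (fun i => (((d i)⁻¹ : ℝ) : 𝕂)) with hDi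
  have DiD : Di * D = 1 := by
    rw [hDi, hD, Matrix.diagonal_mul_diagonal, ← Matrix.diagonal_one]
    congr 1; ext i
    rw [← RCLike.ofReal_mul, inv_mul_cancel₀ (dpos i).ne']; simp
  have sDi : star Di = Di := by
    rw [hDi, Matrix.star_eq_conjTranspose, Matrix.diagonal_conjTranspose]
    congr 1; ext i
    simp
  have DlD : Di * Matrix.diagonal (fun i => (l i : 𝕂)) * Di = 1 := by
    rw [hDi, Matrix.diagonal_mul_diagonal, Matrix.diagonal_mul_diagonal, ← Matrix.diagonal_one]
    congr 1; ext i
    rw [← RCLike.ofReal_mul, ← RCLike.ofReal_mul, ← dsq i]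
    have := (dpos i).ne'
    rw [show (d i)⁻¹ * (d i * d i) * (d i)⁻¹ = 1 by field_simp]
    simp
  set u0 : Matrix (Fin 3) (Fin 3) 𝕂 := M * U * Di with hu0
  have u0u : star u0 * u0 = 1 := by
    have : star u0 * u0 = Di * (star U * (Mᴴ * M) * U) * Di := by
      rw [hu0, star_mul, star_mul, sDi, Matrix.star_eq_conjTranspose M]
      simp only [mul_assoc]
    rw [this, hd, DlD]
  have fac : M = u0 * D * star U := by
    rw [hu0, mul_assoc (M * U), DiD, mul_one, mul_assoc, hU', mul_one]
  have u0m : u0 ∈ Matrix.unitaryGroup (Fin 3) 𝕂 := Matrix.mem_unitaryGroup_iff'.2 u0u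
  have Um : star U ∈ Matrix.unitaryGroup (Fin 3) 𝕂 :=
    Unitary.star_mem (Matrix.mem_unitaryGroup_iff'.2 hU)
  set α := u0.det with hα
  set β := (star U).det with hβ
  have αu := Matrix.det_of_mem_unitary u0m
  have βu := Matrix.det_of_mem_unitary Um
  have αn : ‖α‖ = 1 := CStarRing.norm_of_mem_unitary αu
  have βn : ‖β‖ = 1 := CStarRing.norm_of_mem_unitary βu
  have dt : α * ((d 0 * d 1 * d 2 : ℝ) : 𝕂) * β = 1 := by
    have h1 : M.det = 1 := g.2
    rw [fac, Matrix.det_mul, Matrix.det_mul, hD, Matrix.det_diagonal, Fin.prod_univ_three] at h1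
    push_cast
    exact h1
  have dprod : d 0 * d 1 * d 2 = 1 := by
    have := congrArg norm dt
    rw [norm_mul, norm_mul, αn, βn, one_mul, mul_one, norm_one, RCLike.norm_ofReal,
      abs_of_pos (mul_pos (mul_pos (dpos 0) (dpos 1)) (dpos 2))] at this
    exact this
  have αβ : α * β = 1 := by
    rw [dprod] at dt
    simpa using dt
  set P : Matrix (Fin 3) (Fin 3) 𝕂 := Matrix.diagonal ![α, 1, 1] with hP
  set P' : Matrix (Fin 3) (Fin 3) 𝕂 := Matrix.diagonal ![star α, 1, 1] with hP'
  have αα : star α * α = 1 := αu.1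
  have αα' : α * star α = 1 := αu.2
  have PP : P' * P = 1 := by
    rw [hP, hP', Matrix.diagonal_mul_diagonal, ← Matrix.diagonal_one]
    congr 1; ext i
    fin_cases i
    · simpa using αα
    · simp
    · simp
  have sP : star P = P' := by
    rw [hP, hP', Matrix.star_eq_conjTranspose, Matrix.diagonal_conjTranspose]
    congr 1; ext i
    fin_cases i <;> simp
  have PDP : P' * D * P = D := by
    rw [hP, hP', hD, Matrix.diagonal_mul_diagonal, Matrix.diagonal_mul_diagonal]
    congr 1; ext i
    fin_cases i
    · simp only [Fin.zero_eta, Matrix.cons_val_zero]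
      rw [mul_right_comm, αα, one_mul]
    · simp
    · simp
  have Pm : P ∈ Matrix.unitaryGroup (Fin 3) 𝕂 := by
    rw [Matrix.mem_unitaryGroup_iff', sP, PP]
  have P'm : P' ∈ Matrix.unitaryGroup (Fin 3) 𝕂 := by
    rw [← sP]; exact Unitary.star_mem Pm
  have detP : P.det = α := by
    rw [hP, Matrix.det_diagonal, Fin.prod_univ_three]; simp
  have detP' : P'.det = star α := by
    rw [hP', Matrix.det_diagonal, Fin.prod_univ_three]; simp
  refine ⟨⟨u0 * P', by rw [Matrix.det_mul, detP']; exact αα'⟩, mul_mem u0m P'm,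
    ⟨P * star U, by rw [Matrix.det_mul, detP]; exact αβ⟩, mul_mem Pm Um,
    Real.log (d 0), Real.log (d 2), ?_⟩
  have e1 : -Real.log (d 0) - Real.log (d 2) = Real.log (d 1) := by
    have := congrArg Real.log dprod
    rw [Real.log_mul (mul_pos (dpos 0) (dpos 1)).ne' (dpos 2).ne',
      Real.log_mul (dpos 0).ne' (dpos 1).ne', Real.log_one] at this
    linarith
  refine ⟨?_, ?_, ?_⟩
  · rw [e1]; exact Real.log_le_log (dpos 2) (Real.sqrt_le_sqrt h12)
  · rw [e1]; exact Real.log_le_log (dpos 1) (Real.sqrt_le_sqrt h01)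
  · apply Subtype.ext
    change M = (u0 * P') * ((ex 𝕂 (Real.log (d 0)) (Real.log (d 2)) : SL3 𝕂) :
      Matrix (Fin 3) (Fin 3) 𝕂) * (P * star U)
    rw [ex_coe, e1, Real.exp_log (dpos 0), Real.exp_log (dpos 1), Real.exp_log (dpos 2)]
    have : (Matrix.diagonal ![((d 0 : ℝ) : 𝕂), ((d 1 : ℝ) : 𝕂), ((d 2 : ℝ) : 𝕂)] :
        Matrix (Fin 3) (Fin 3) 𝕂) = D := by
      rw [hD]; congr 1; ext i; fin_cases i <;> simp
    rw [this]
    calc M = u0 * (P' * D * P) * star U := by rw [PDP]; exact fac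
      _ = _ := by simp only [mul_assoc]

/-- cyclic permutation matrix -/
def cy (𝕂 : Type) [RCLike 𝕂] : SL3 𝕂 :=
  ⟨!![0, 1, 0; 0, 0, 1; 1, 0, 0], by simp [Matrix.det_fin_three]⟩

lemma cy_mem : cy 𝕂 ∈ KK 𝕂 := by
  rw [mem_KK, Matrix.mem_unitaryGroup_iff']
  ext i j
  fin_cases i <;> fin_cases j <;> simp [cy, Matrix.mul_apply, Fin.sum_univ_three, Matrix.star_apply]

lemma cy_ex (x y : ℝ) : ex 𝕂 x y * cy 𝕂 * ex 𝕂 x y * cy 𝕂 * ex 𝕂 x y = (cy 𝕂)⁻¹ := by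
  have key : ex 𝕂 x y * cy 𝕂 * ex 𝕂 x y * cy 𝕂 * ex 𝕂 x y * cy 𝕂 = 1 := by
    have h : ((Real.exp x : ℝ) : 𝕂) * ((Real.exp (-x - y) : ℝ) : 𝕂) * ((Real.exp y : ℝ) : 𝕂) = 1 := by
      rw [← RCLike.ofReal_mul, ← RCLike.ofReal_mul, ← Real.exp_add, ← Real.exp_add]
      rw [show x + (-x - y) + y = 0 by ring]
      simp
    apply Subtype.ext
    simp only [Matrix.SpecialLinearGroup.coe_mul, ex_coe, Matrix.SpecialLinearGroup.coe_one]
    generalize ((Real.exp x : ℝ) : 𝕂) = a at *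
    generalize ((Real.exp (-x - y) : ℝ) : 𝕂) = b at *
    generalize ((Real.exp y : ℝ) : 𝕂) = c at *
    ext i j
    fin_cases i <;> fin_cases j <;>
      simp [cy, Matrix.mul_apply, Fin.sum_univ_three, Matrix.diagonal_apply]
    · linear_combination h
    · linear_combination h
    · linear_combination h
  exact eq_inv_of_mul_eq_one_left key

lemma cyc (h : SL3 𝕂) : ∃ k ∈ KK 𝕂, ∃ x ∈ KK 𝕂, ∃ y ∈ KK 𝕂, h * k * h = x * h⁻¹ * y := by
  obtain ⟨u, hu, v, hv, s, t, -, -, e⟩ := svd h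
  have hk : v⁻¹ * cy 𝕂 * u⁻¹ ∈ KK 𝕂 :=
    (KK 𝕂).mul_mem ((KK 𝕂).mul_mem ((KK 𝕂).inv_mem hv) cy_mem) ((KK 𝕂).inv_mem hu)
  refine ⟨v⁻¹ * cy 𝕂 * u⁻¹, hk, u * (cy 𝕂)⁻¹ * v,
    (KK 𝕂).mul_mem ((KK 𝕂).mul_mem hu ((KK 𝕂).inv_mem cy_mem)) hv,
    (v⁻¹ * cy 𝕂 * u⁻¹)⁻¹, (KK 𝕂).inv_mem hk, ?_⟩
  rw [← cy_ex (𝕂 := 𝕂) s t, e]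
  group

lemma svd_nu {u v : SL3 𝕂} (hu : u ∈ KK 𝕂) (hv : v ∈ KK 𝕂) (a : SL3 𝕂) :
    |nu (u * a * v) - nu a| ≤ 2 * Real.log 9 := by
  have h1 := nu_mul (u * a) v
  have h2 := nu_mul u a
  have h3 := nu_mul (u⁻¹ * (u * a * v)) v⁻¹
  have h4 := nu_mul u⁻¹ (u * a * v)
  rw [show u⁻¹ * (u * a * v) * v⁻¹ = a by group] at h3
  have := nu_KK hu
  have := nu_KK hv
  have := nu_KK ((KK 𝕂).inv_mem hu)
  have := nu_KK ((KK 𝕂).inv_mem hv)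
  rw [abs_le]
  constructor <;> linarith

lemma near (D : ℝ) : ∃ ρ : ℝ, ∀ g g' : SL3 𝕂, |nu g - nu g'| ≤ D → |nu g⁻¹ - nu g'⁻¹| ≤ D →
    ∃ x y, ln nu x ≤ ρ ∧ ln nu y ≤ ρ ∧ g = x * g' * y := by
  have l9 : 0 ≤ Real.log 9 := Real.log_nonneg (by norm_num)
  have l3 : 0 ≤ Real.log 3 := Real.log_nonneg (by norm_num)
  set E := D + 4 * Real.log 9 + Real.log 3 with hE
  refine ⟨2 * Real.log 9 + Real.log 3 + 2 * E, fun g g' h1 h2 => ?_⟩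
  obtain ⟨u, hu, v, hv, x, y, o1, o2, e⟩ := svd g
  obtain ⟨u', hu', v', hv', x', y', o1', o2', e'⟩ := svd g'
  have bound : ∀ {g u v : SL3 𝕂} {x y : ℝ}, u ∈ KK 𝕂 → v ∈ KK 𝕂 → y ≤ -x - y → -x - y ≤ x →
      g = u * ex 𝕂 x y * v → (x - 2 * Real.log 9 ≤ nu g ∧ nu g ≤ x + 2 * Real.log 9 + Real.log 3) ∧
      (-y - 2 * Real.log 9 ≤ nu g⁻¹ ∧ nu g⁻¹ ≤ -y + 2 * Real.log 9 + Real.log 3) := by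
    intro g u v x y hu hv o1 o2 e
    have k1 := svd_nu hu hv (ex 𝕂 x y)
    have k2 := svd_nu ((KK 𝕂).inv_mem hv) ((KK 𝕂).inv_mem hu) (ex 𝕂 x y)⁻¹
    have e3 : g⁻¹ = v⁻¹ * (ex 𝕂 x y)⁻¹ * u⁻¹ := by rw [e]; group
    rw [← e3, ex_inv] at k2
    rw [← e] at k1
    have a1 := (le_nu_ex (𝕂 := 𝕂) x y).1
    have a2 := (le_nu_ex (𝕂 := 𝕂) (-x) (-y)).2
    have a3 : nu (ex 𝕂 x y) ≤ Real.log 3 + x := nu_ex_le le_rfl o2 (o1.trans o2)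
    have a4 : nu (ex 𝕂 (-x) (-y)) ≤ Real.log 3 + -y :=
      nu_ex_le (by linarith) (by linarith) le_rfl
    rw [abs_le] at k1 k2
    refine ⟨⟨?_, ?_⟩, ?_, ?_⟩ <;> linarith
  obtain ⟨⟨b1, b2⟩, b3, b4⟩ := bound hu hv o1 o2 e
  obtain ⟨⟨c1, c2⟩, c3, c4⟩ := bound hu' hv' o1' o2' e'
  rw [abs_le] at h1 h2
  refine ⟨u * ex 𝕂 (x - x') (y - y') * u'⁻¹, v'⁻¹ * v, ?_, ?_, ?_⟩
  · have m1 := ln_mul nu_mul (u * ex 𝕂 (x - x') (y - y')) u'⁻¹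
    have m2 := ln_mul nu_mul u (ex 𝕂 (x - x') (y - y'))
    have m3 := ln_KK hu
    have m4 := ln_KK ((KK 𝕂).inv_mem hu')
    have m5 : ln nu (ex 𝕂 (x - x') (y - y')) ≤ Real.log 3 + 2 * E := by
      refine max_le (nu_ex_le (by linarith) (by linarith) (by linarith)) ?_
      rw [ex_inv]
      exact nu_ex_le (by linarith) (by linarith) (by linarith)
    linarith
  · have m1 := ln_KK ((KK 𝕂).mul_mem ((KK 𝕂).inv_mem hv') hv)
    linarith
  · have : ex 𝕂 (x - x') (y - y') * ex 𝕂 x' y' = ex 𝕂 x y := by rw [ex_mul]; simp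
    rw [e, e', ← this]
    group

end svd2
end OWM

namespace OWM
section gen
variable (𝕂 : Type) [RCLike 𝕂]
open Matrix.SpecialLinearGroup

/-- bounded elementary matrices -/
def Pone : Set (SL3 𝕂) :=
  ⋃ p : {p : Fin 3 × Fin 3 // p.1 ≠ p.2},
    (fun t : 𝕂 => (transvection p.2 t : SL3 𝕂)) '' Metric.closedBall 0 1

/-- products of bounded elementary matrices -/
def Pn : ℕ → Set (SL3 𝕂)
  | 0 => {1}
  | n + 1 => (fun q : SL3 𝕂 × SL3 𝕂 => q.1 * q.2) '' (Pn n ×ˢ Pone 𝕂)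

variable {𝕂}

lemma continuous_transvection {i j : Fin 3} (h : i ≠ j) :
    Continuous (fun t : 𝕂 => (transvection h t : SL3 𝕂)) := by
  refine isInducing_coe.continuous_iff.2 ?_
  have : ((fun g : SL3 𝕂 => (g : Matrix (Fin 3) (Fin 3) 𝕂)) ∘
      fun t : 𝕂 => (transvection h t : SL3 𝕂)) = fun t => 1 + Matrix.single i j t := rfl
  rw [this]
  refine continuous_const.add ?_
  refine continuous_matrix fun a b => ?_
  by_cases hab : i = a ∧ j = b
  · simp only [Matrix.single_apply, if_pos hab]; exact continuous_id
  · simp only [Matrix.single_apply, if_neg hab]; exact continuous_const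

lemma mem_Pone {i j : Fin 3} (h : i ≠ j) {t : 𝕂} (ht : ‖t‖ ≤ 1) :
    (transvection h t : SL3 𝕂) ∈ Pone 𝕂 :=
  Set.mem_iUnion.2 ⟨⟨(i, j), h⟩, t, by simpa using ht, rfl⟩

lemma one_mem_Pone : (1 : SL3 𝕂) ∈ Pone 𝕂 := by
  rw [← transvection_coeff_zero (F := 𝕂) (show (0 : Fin 3) ≠ 1 by decide)]
  exact mem_Pone _ (by simp)

lemma isCompact_Pone : IsCompact (Pone 𝕂) :=
  isCompact_iUnion fun p => (isCompact_closedBall _ _).image (continuous_transvection p.2)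

lemma isPreconnected_Pone : IsPreconnected (Pone 𝕂) := by
  refine isPreconnected_iUnion
    ⟨1, Set.mem_iInter.2 fun p => ⟨0, by simp, transvection_coeff_zero p.2⟩⟩ fun p => ?_
  exact ((convex_closedBall (0 : 𝕂) 1).isPreconnected).image _
    (continuous_transvection p.2).continuousOn

lemma one_mem_Pn (n : ℕ) : (1 : SL3 𝕂) ∈ Pn 𝕂 n := by
  induction n with
  | zero => exact rfl
  | succ n ih => exact ⟨(1, 1), ⟨ih, one_mem_Pone⟩, one_mul 1⟩

lemma isCompact_Pn (n : ℕ) : IsCompact (Pn 𝕂 n) := by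
  induction n with
  | zero => exact isCompact_singleton
  | succ n ih => exact (ih.prod isCompact_Pone).image continuous_mul

lemma isPreconnected_Pn (n : ℕ) : IsPreconnected (Pn 𝕂 n) := by
  induction n with
  | zero => exact isPreconnected_singleton
  | succ n ih => exact (ih.prod isPreconnected_Pone).image _ continuous_mul.continuousOn

lemma mul_mem_Pn {n m : ℕ} {a b : SL3 𝕂} (ha : a ∈ Pn 𝕂 n) (hb : b ∈ Pn 𝕂 m) :
    a * b ∈ Pn 𝕂 (n + m) := by
  induction m generalizing b with
  | zero =>
    have : b = 1 := hb
    subst this; simpa using ha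
  | succ m ih =>
    obtain ⟨⟨x, y⟩, ⟨hx, hy⟩, rfl⟩ := hb
    exact ⟨(a * x, y), ⟨ih hx, hy⟩, mul_assoc a x y⟩

lemma Pn_mono : Monotone (Pn 𝕂) := by
  refine monotone_nat_of_le_succ fun n a ha => ?_
  exact ⟨(a, 1), ⟨ha, one_mem_Pone⟩, mul_one a⟩

/-- membership in some `Pn` -/
def Gen (g : SL3 𝕂) : Prop := ∃ n, g ∈ Pn 𝕂 n

lemma Gen.mul {a b : SL3 𝕂} : Gen a → Gen b → Gen (a * b) :=
  fun ⟨n, hn⟩ ⟨m, hm⟩ => ⟨n + m, mul_mem_Pn hn hm⟩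

lemma gen_transvection {i j : Fin 3} (h : i ≠ j) (a : 𝕂) : Gen (transvection h a : SL3 𝕂) := by
  obtain ⟨n, hn⟩ := exists_nat_gt ‖a‖
  have hn0 : (0 : ℝ) < n := (norm_nonneg a).trans_lt hn
  have hn1 : (n : 𝕂) ≠ 0 := by
    have : n ≠ 0 := by rintro rfl; simp at hn0
    exact_mod_cast this
  have hb : ‖a / n‖ ≤ 1 := by
    rw [norm_div, RCLike.norm_natCast, div_le_one hn0]; exact hn.le
  have h1 : Gen (transvection h (a / n) : SL3 𝕂) :=
    ⟨1, ⟨(1, _), ⟨rfl, mem_Pone h hb⟩, one_mul _⟩⟩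
  have key : ∀ k : ℕ, Gen (transvection h ((k : 𝕂) * (a / n)) : SL3 𝕂) := by
    intro k
    induction k with
    | zero =>
      simp only [Nat.cast_zero, zero_mul, transvection_coeff_zero]; exact ⟨0, rfl⟩
    | succ k ih =>
      have e : ((k + 1 : ℕ) : 𝕂) * (a / n) = k * (a / n) + a / n := by push_cast; ring
      rw [e, transvection_add]
      exact ih.mul h1
  have := key n
  rwa [mul_div_cancel₀ _ hn1] at this

set_option maxHeartbeats 4000000 in
lemma diag2n_eq {i j : Fin 3} (h : i ≠ j) {a : 𝕂} (ha : a ≠ 0) :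
    (diag2n h a ha : SL3 𝕂) = transvection h a * transvection h.symm (-a⁻¹) * transvection h a *
      transvection h (-1) * transvection h.symm 1 * transvection h (-1) := by
  apply Subtype.ext
  simp only [coe_mul, transvection_coe, diag2n_coe]
  revert h
  fin_cases i <;> fin_cases j <;> intro h <;> first | exact absurd rfl h | skip
  all_goals
    ext k l
    fin_cases k <;> fin_cases l <;>
      simp [Matrix.mul_apply, Fin.sum_univ_three, Matrix.single_apply, Matrix.one_apply, ha]

lemma gen_all (g : SL3 𝕂) : Gen g := by
  refine diagonal_transvection_induction' Gen g ?_ (fun i j h a => gen_transvection h a)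
    fun A B => Gen.mul
  intro i j h c hc
  rw [diag2n_eq]
  exact (((((gen_transvection _ _).mul (gen_transvection _ _)).mul (gen_transvection _ _)).mul
    (gen_transvection _ _)).mul (gen_transvection _ _)).mul (gen_transvection _ _)

lemma iUnion_Pn : ⋃ n, Pn 𝕂 n = Set.univ :=
  Set.eq_univ_of_forall fun g => Set.mem_iUnion.2 (gen_all g)

instance preconn : PreconnectedSpace (SL3 𝕂) where
  isPreconnected_univ := by
    rw [← iUnion_Pn]
    exact isPreconnected_iUnion ⟨1, Set.mem_iInter.2 one_mem_Pn⟩ isPreconnected_Pn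

lemma exists_interior : ∃ N : ℕ, ∀ m : ℕ, ∀ g ∈ Pn 𝕂 m, g ∈ interior (Pn 𝕂 (m + N)) := by
  have : T2Space (SL3 𝕂) := isClosedEmbedding_coe.isEmbedding.t2Space
  have : LocallyCompactSpace (Matrix (Fin 3) (Fin 3) 𝕂) :=
    inferInstanceAs (LocallyCompactSpace (Fin 3 → Fin 3 → 𝕂))
  have : LocallyCompactSpace (SL3 𝕂) := isClosedEmbedding_coe.locallyCompactSpace
  obtain ⟨n, p, hp⟩ := nonempty_interior_of_iUnion_of_closed
    (fun n => (isCompact_Pn (𝕂 := 𝕂) n).isClosed) iUnion_Pn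
  obtain ⟨k, hk⟩ := gen_all p⁻¹
  refine ⟨k + n, fun m g hg => ?_⟩
  rw [mem_interior]
  refine ⟨(fun x => p * g⁻¹ * x) ⁻¹' interior (Pn 𝕂 n), ?_,
    isOpen_interior.preimage (continuous_const.mul continuous_id), by simpa using hp⟩
  intro x hx
  have h1 := mul_mem_Pn hg (mul_mem_Pn hk (interior_subset hx))
  convert h1 using 1
  group

lemma exists_cover {S : Set (SL3 𝕂)} (hS : IsCompact S) : ∃ N, S ⊆ Pn 𝕂 N := by
  obtain ⟨N, hN⟩ := exists_interior (𝕂 := 𝕂)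
  obtain ⟨m, hm⟩ := hS.elim_directed_cover (fun n => interior (Pn 𝕂 n))
    (fun n => isOpen_interior) (fun g _ => by
      obtain ⟨m, hm⟩ := gen_all g
      exact Set.mem_iUnion.2 ⟨m + N, hN m g hm⟩)
    (directed_of_isDirected_le fun a b h => interior_mono (Pn_mono h))
  exact ⟨m, hm.trans interior_subset⟩

theorem exists_setup (𝕂 : Type) [RCLike 𝕂] : ∃ W, Setup (SL3 𝕂) nu W := by
  obtain ⟨N, hN⟩ := exists_cover (isCompact_ball (𝕂 := 𝕂) (Real.log 9))
  have hK : ∀ k ∈ KK 𝕂, k ∈ Pn 𝕂 N := fun k hk => hN (ln_KK hk)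
  refine ⟨Pn 𝕂 N, nu_mul, isOpen_ball, isPreconnected_Pn N, one_mem_Pn N,
    compact_bdd (isCompact_Pn N), fun h => ?_, near⟩
  obtain ⟨k, hk, x, hx, y, hy, e⟩ := cyc h
  exact ⟨k, hK k hk, x, hK x hx, y, hK y hy, e⟩

end gen
end OWM

/-- **Oh–Witte-Morris.**  Let `𝕂` be `ℝ` or `ℂ` and let `H` be a closed connected subgroup
of `SL(3, 𝕂)`.  If some discrete subgroup `Γ` of `SL(3, 𝕂)` acts freely, properly
discontinuously and cocompactly on `SL(3, 𝕂)/H` by left multiplication, then either `H` is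
compact or `SL(3, 𝕂)/H` is compact. -/
theorem oh_witteMorris_SL3 (𝕂 : Type) [RCLike 𝕂]
    (H : Subgroup (Matrix.SpecialLinearGroup (Fin 3) 𝕂))
    (hclosed : IsClosed (H : Set (Matrix.SpecialLinearGroup (Fin 3) 𝕂)))
    (hconn : IsConnected (H : Set (Matrix.SpecialLinearGroup (Fin 3) 𝕂)))
    (hexists : ∃ Γ : Subgroup (Matrix.SpecialLinearGroup (Fin 3) 𝕂),
      DiscreteTopology Γ ∧
      (∀ γ : Γ, (∃ x : Matrix.SpecialLinearGroup (Fin 3) 𝕂 ⧸ H,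
        (γ : Matrix.SpecialLinearGroup (Fin 3) 𝕂) • x = x) → γ = 1) ∧
      (∀ K L : Set (Matrix.SpecialLinearGroup (Fin 3) 𝕂 ⧸ H),
        IsCompact K → IsCompact L →
        {γ : Γ | ∃ x ∈ K, ((γ : Matrix.SpecialLinearGroup (Fin 3) 𝕂) • x) ∈ L}.Finite) ∧
      (∃ K : Set (Matrix.SpecialLinearGroup (Fin 3) 𝕂 ⧸ H), IsCompact K ∧
        ∀ x : Matrix.SpecialLinearGroup (Fin 3) 𝕂 ⧸ H, ∃ γ ∈ Γ, ∃ y ∈ K, γ • y = x)) :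
    IsCompact (H : Set (Matrix.SpecialLinearGroup (Fin 3) 𝕂)) ∨
      CompactSpace (Matrix.SpecialLinearGroup (Fin 3) 𝕂 ⧸ H) := by
  obtain ⟨Γ, _, _, hpd, hco⟩ := hexists
  obtain ⟨W, s⟩ := OWM.exists_setup 𝕂
  exact OWM.final_of s H Γ hclosed hconn hpd hco
end

section
/- (Salein) Let Γ be a group and let ρ₀, ρ : Γ → SL(2,ℝ) be homomorphisms, with ρ₀ injective and with discrete image. Suppose there exist a constant C < 1 and a map f : ℍ² → ℍ² of the hyperbolic plane which is Lipschitz with constant C (for the hyperbolic distance) and (ρ₀, ρ)-equivariant, i.e., f(ρ₀(γ) · z) = ρ(γ) · f(z) for all γ ∈ Γ and z ∈ ℍ². Then the action of Γ on SL(2,ℝ) defined by γ • x = ρ(γ) · x · ρ₀(γ)⁻¹ is properly discontinuous. -/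
open Matrix

/-- The matrix topology on `SL(2, ℝ)`, induced from the space of matrices. -/
noncomputable instance : TopologicalSpace (Matrix.SpecialLinearGroup (Fin 2) ℝ) :=
  TopologicalSpace.induced (fun g => (g : Matrix (Fin 2) (Fin 2) ℝ)) inferInstance

theorem salein_aux {Γ G X : Type} [Group Γ] [Group G] [TopologicalSpace G] [MetricSpace X]
    [ProperSpace X] [MulAction G X] [IsIsometricSMul G X] [ContinuousSMul G X]
    (ρ₀ ρ : Γ →* G) (hinj : Function.Injective ρ₀) [hpd : ProperlyDiscontinuousSMul ρ₀.range X]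
    (z : X) (C : NNReal) (hC : C < 1) (f : X → X) (hf : LipschitzWith C f)
    (hequiv : ∀ (γ : Γ) (z : X), f (ρ₀ γ • z) = ρ γ • f z)
    (K L : Set G) (hK : IsCompact K) (hL : IsCompact L) :
    {γ : Γ | ∃ x ∈ K, ρ γ * x * (ρ₀ γ)⁻¹ ∈ L}.Finite := by
  obtain ⟨A, hA⟩ := hK.bddAbove_image (f := fun x : G => dist (x • z) (f z))
    (by fun_prop)
  obtain ⟨B, hB⟩ := hL.bddAbove_image (f := fun x : G => dist (x • z) z)
    (by fun_prop)
  have hC' : (0 : ℝ) < 1 - C := by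
    have : (C : ℝ) < 1 := by exact_mod_cast hC
    linarith
  set R : ℝ := (B + A + dist (f z) z) / (1 - C) with hR
  have hfin := hpd.finite_disjoint_inter_image (isCompact_singleton (x := z))
    (isCompact_closedBall z R)
  refine Set.Finite.of_injOn (f := fun γ : Γ => (⟨ρ₀ γ, γ, rfl⟩ : ρ₀.range)) (s := _) ?_ ?_ hfin
  · rintro γ ⟨x, hx, hy⟩
    refine ⟨ρ₀ γ • z, ⟨z, rfl, rfl⟩, ?_⟩
    rw [Metric.mem_closedBall, hR, le_div_iff₀ hC']
    have h1 : dist (x • z) (f z) ≤ A := hA ⟨x, hx, rfl⟩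
    set y := ρ γ * x * (ρ₀ γ)⁻¹ with hydef
    have h2 : dist (y • z) z ≤ B := hB ⟨y, hy, rfl⟩
    have h3 : y • ρ₀ γ • z = ρ γ • x • z := by
      rw [smul_smul, smul_smul, hydef, inv_mul_cancel_right]
    have h4 : dist (ρ₀ γ • z) z = dist (y • ρ₀ γ • z) (y • z) := (dist_smul y _ _).symm
    have h5 : dist (ρ γ • x • z) (ρ γ • f z) ≤ A := by rwa [dist_smul]
    have h6 : dist (ρ γ • f z) (f z) ≤ C * dist (ρ₀ γ • z) z := by
      rw [← hequiv]; exact hf.dist_le_mul _ _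
    rw [h3] at h4
    have t1 := dist_triangle (ρ γ • x • z) (ρ γ • f z) (y • z)
    have t2 := dist_triangle (ρ γ • f z) (f z) (y • z)
    have t3 := dist_triangle (f z) z (y • z)
    rw [dist_comm z (y • z)] at t3
    nlinarith
  · intro a _ b _ hab
    exact hinj (congrArg Subtype.val hab)

/-- **Salein's criterion.**  Let `ρ₀, ρ : Γ → SL(2, ℝ)` be homomorphisms with `ρ₀` injective
with discrete image.  If there are `C < 1` and a `C`-Lipschitz map `f : ℍ² → ℍ²` (for the
hyperbolic metric) which is `(ρ₀, ρ)`-equivariant, then the action of `Γ` on `SL(2, ℝ)`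
given by `γ • x = ρ(γ) · x · ρ₀(γ)⁻¹` is properly discontinuous. -/
theorem salein_admissibility_criterion (Γ : Type) [Group Γ]
    (ρ₀ ρ : Γ →* Matrix.SpecialLinearGroup (Fin 2) ℝ)
    (hinj : Function.Injective ρ₀)
    (hdisc : DiscreteTopology ρ₀.range)
    (C : NNReal) (hC : C < 1)
    (f : UpperHalfPlane → UpperHalfPlane) (hf : LipschitzWith C f)
    (hequiv : ∀ (γ : Γ) (z : UpperHalfPlane), f (ρ₀ γ • z) = ρ γ • f z) :
    ∀ K L : Set (Matrix.SpecialLinearGroup (Fin 2) ℝ), IsCompact K → IsCompact L →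
      {γ : Γ | ∃ x ∈ K, ρ γ * x * (ρ₀ γ)⁻¹ ∈ L}.Finite := by
  intro K L hK hL
  have h2 := @UpperHalfPlane.instProperlyDiscontinuousSL2RSubgroup ρ₀.range hdisc
  exact @salein_aux Γ _ _ _ _ Matrix.SpecialLinearGroup.instTopologicalSpace _ _ _ _
    UpperHalfPlane.instContinuousSMulSL2R ρ₀ ρ hinj h2 UpperHalfPlane.I C hC f hf hequiv
    K L hK hL
end
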